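/- arXiv:1302.2017 — 3 statements merged into one kernel-verified Lean document; each statement's English description precedes it below -/
import Mathlib

section
/- Consider a constrained strategic game Γ satisfying Assumptions 1 and 3 that is a constrained potential game with potential function φ. Let D_i be the minimal number of constraint-feasible steps needed to transition between any two actions of player i (the diameter of the graph on A_i with edges given by C_i), D = max_i D_i, and C = max_i max_{a_i ∈ A_i} |C_i(a_i)|. Suppose each player follows PIPIP, i.e., at each round k ≥ 2 the PHPIP selection rule is applied with the time-varying exploration rate ε(k) = k^{−1/(n(D+1))}, and the parameter κ satisfies κ ∈ (1/(C−1), 1/2]. Then lim_{k→∞} Prob[ a(k) ∈ argmax_{a ∈ A} φ(a) ] = 1, where a(k) denotes the joint action at round k. -/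
open Filter Topology Set

attribute [local instance] Classical.propDecidable

section PHPIP

variable {ι : Type*} [Fintype ι] [DecidableEq ι] {A : ι → Type*} [∀ i, Fintype (A i)]

/-- Assumption 1 on the constraint maps. -/
def Assumption1 (C : ∀ i, A i → Finset (A i)) : Prop :=
  (∀ (i : ι) (a b : A i), b ∈ C i a ↔ a ∈ C i b) ∧
  (∀ (i : ι) (a b : A i), ∃ (nf : ℕ) (f : ℕ → A i), f 0 = a ∧ f nf = b ∧
      ∀ k < nf, f (k + 1) ∈ C i (f k)) ∧
  (∀ (i : ι) (a : A i), 3 ≤ (C i a).card)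

/-- Assumption 3: unilateral constrained deviations change the utility by less than 1/2. -/
def Assumption3 (U : ι → (∀ i, A i) → ℝ) (C : ∀ i, A i → Finset (A i)) : Prop :=
  ∀ (i : ι) (a : ∀ j, A j) (b : A i), b ∈ C i (a i) →
    U i (Function.update a i b) - U i a < 1 / 2

/-- Γ is a constrained potential game with potential function φ. -/
def IsPotentialGame (U : ι → (∀ i, A i) → ℝ) (C : ∀ i, A i → Finset (A i))
    (φ : (∀ i, A i) → ℝ) : Prop :=
  ∀ (i : ι) (a : ∀ j, A j) (b : A i), b ∈ C i (a i) →
    U i (Function.update a i b) - U i a = φ (Function.update a i b) - φ a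

/-- Probability that, from state `(a0, a1)`, player `i` selects the action `x`
under the PHPIP selection rule with exploration rate `ε` and parameter `κ`. -/
noncomputable def selProb (κ : ℝ) (U : ι → (∀ i, A i) → ℝ)
    (C : ∀ i, A i → Finset (A i)) (ε : ℝ) (a0 a1 : ∀ i, A i) (i : ι) (x : A i) : ℝ :=
  if U i a0 ≤ U i a1 then
    (if x = a1 i then 1 - ε else 0) +
      (if x ∈ (C i (a1 i)).erase (a1 i) then
        ε / ((C i (a1 i)).erase (a1 i)).card else 0)
  else
    (if x = a1 i then (1 - ε) * (κ * ε ^ (U i a0 - U i a1)) else 0) +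
      (if x = a0 i then (1 - ε) * (1 - κ * ε ^ (U i a0 - U i a1)) else 0) +
      (if x ∈ ((C i (a1 i)).erase (a1 i)).erase (a0 i) then
        ε / (((C i (a1 i)).erase (a1 i)).erase (a0 i)).card else 0)

/-- One-step transition probability of the Markov chain `{P^ε}` induced by PHPIP
on pairs of joint actions. -/
noncomputable def phTrans (κ : ℝ) (U : ι → (∀ i, A i) → ℝ)
    (C : ∀ i, A i → Finset (A i)) (ε : ℝ)
    (z1 z2 : (∀ i, A i) × (∀ i, A i)) : ℝ :=
  if z2.1 = z1.2 then ∏ i, selProb κ U C ε z1.1 z1.2 i (z2.2 i) else 0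

/-- The state space B. -/
def memB (C : ∀ i, A i → Finset (A i)) (z : (∀ i, A i) × (∀ i, A i)) : Prop :=
  ∀ i, z.2 i ∈ C i (z.1 i)

/-- k-step transition probabilities of the homogeneous chain `{P^ε}`. -/
noncomputable def phTransPow (κ : ℝ) (U : ι → (∀ i, A i) → ℝ)
    (C : ∀ i, A i → Finset (A i)) (ε : ℝ) :
    ℕ → (∀ i, A i) × (∀ i, A i) → (∀ i, A i) × (∀ i, A i) → ℝ
  | 0, z, z' => if z = z' then 1 else 0
  | k + 1, z, z' => ∑ w : (∀ i, A i) × (∀ i, A i),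
      phTrans κ U C ε z w * phTransPow κ U C ε k w z'

/-- Probability of a path (sequence of states) of the chain `{P^ε}`. -/
noncomputable def pathProb (κ : ℝ) (U : ι → (∀ i, A i) → ℝ)
    (C : ∀ i, A i → Finset (A i)) (ε : ℝ) :
    List ((∀ i, A i) × (∀ i, A i)) → ℝ
  | [] => 1
  | [_] => 1
  | z :: z' :: rest => phTrans κ U C ε z z' * pathProb κ U C ε (z' :: rest)

/-- A transition is feasible if it has positive probability for some ε ∈ (0,1/2]. -/
def Feasible (κ : ℝ) (U : ι → (∀ i, A i) → ℝ) (C : ∀ i, A i → Finset (A i))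
    (z z' : (∀ i, A i) × (∀ i, A i)) : Prop :=
  ∃ ε : ℝ, 0 < ε ∧ ε ≤ 1 / 2 ∧ 0 < phTrans κ U C ε z z'

/-- `l` is a (feasible) path of the chain from `z1` to `z2`. -/
def IsPath (κ : ℝ) (U : ι → (∀ i, A i) → ℝ) (C : ∀ i, A i → Finset (A i))
    (z1 z2 : (∀ i, A i) × (∀ i, A i)) (l : List ((∀ i, A i) × (∀ i, A i))) : Prop :=
  l.head? = some z1 ∧ l.getLast? = some z2 ∧ l.Chain' (Feasible κ U C)

/-- `r` is the resistance of the path `l`:  `lim_{ε→0+} P^ε(l)/ε^r ∈ (0,∞)`. -/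
def IsPathRes (κ : ℝ) (U : ι → (∀ i, A i) → ℝ) (C : ∀ i, A i → Finset (A i))
    (l : List ((∀ i, A i) × (∀ i, A i))) (r : ℝ) : Prop :=
  ∃ L : ℝ, 0 < L ∧
    Tendsto (fun ε : ℝ => pathProb κ U C ε l / ε ^ r) (𝓝[>] (0 : ℝ)) (𝓝 L)

/-- `(a, b)` (as diagonal states `((a,a),(b,b))`) is a pair in `E_s`:
exactly one player deviates and the deviation is feasible. -/
def EsPair (C : ∀ i, A i → Finset (A i)) (a b : ∀ i, A i) : Prop :=
  (∃! i, a i ≠ b i) ∧ ∀ i, a i ≠ b i → b i ∈ C i (a i)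

/-- The path (list of states) of the M-straight-route through the given diagonal nodes. -/
def msrPath : List (∀ i, A i) → List ((∀ i, A i) × (∀ i, A i))
  | [] => []
  | [a] => [(a, a)]
  | a :: b :: rest => (a, a) :: (a, b) :: msrPath (b :: rest)

/-- Weight of the edge of the graph `G_R` from `z` to `z'`: the minimal resistance
among all paths of `{P^ε}` from `z` to `z'`. -/
noncomputable def edgeWeight (κ : ℝ) (U : ι → (∀ i, A i) → ℝ)
    (C : ∀ i, A i → Finset (A i)) (z z' : (∀ i, A i) × (∀ i, A i)) : ℝ :=
  sInf {r : ℝ | ∃ l, IsPath κ U C z z' l ∧ IsPathRes κ U C l r}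

/-- `y` is reachable from `x` in at most `d` constraint-feasible steps. -/
def ReachIn (C : ∀ i, A i → Finset (A i)) (i : ι) : ℕ → A i → A i → Prop
  | 0, x, y => x = y
  | d + 1, x, y => ReachIn C i d x y ∨ ∃ w, ReachIn C i d x w ∧ y ∈ C i w

/-- Inhomogeneous products: `transProd κ U C εs k0 m` is the transition matrix
`P(k0, k0 + m) = ∏_{k'=k0}^{k0+m-1} P_{k'}` of the PIPIP chain with exploration
rates `εs`. -/
noncomputable def transProd (κ : ℝ) (U : ι → (∀ i, A i) → ℝ)
    (C : ∀ i, A i → Finset (A i)) (εs : ℕ → ℝ) (k0 : ℕ) :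
    ℕ → (∀ i, A i) × (∀ i, A i) → (∀ i, A i) × (∀ i, A i) → ℝ
  | 0, z, z' => if z = z' then 1 else 0
  | m + 1, z, z' => ∑ w : (∀ i, A i) × (∀ i, A i),
      transProd κ U C εs k0 m z w * phTrans κ U C (εs (k0 + m)) w z'

/-- The PIPIP exploration rate `ε(k) = k^{-1/(n(D+1))}`. -/
noncomputable def pipipRate (n D : ℕ) (k : ℕ) : ℝ :=
  (k : ℝ) ^ (-(1 : ℝ) / ((n : ℝ) * ((D : ℝ) + 1)))

/-- Accessibility along the unperturbed chain `{P^0}`. -/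
def Accessible0 (κ : ℝ) (U : ι → (∀ i, A i) → ℝ) (C : ∀ i, A i → Finset (A i))
    (z z' : (∀ i, A i) × (∀ i, A i)) : Prop :=
  ∃ k : ℕ, 0 < phTransPow κ U C 0 k z z'

/-- A recurrent communication class of the unperturbed chain `{P^0}`. -/
def IsRecClass (κ : ℝ) (U : ι → (∀ i, A i) → ℝ) (C : ∀ i, A i → Finset (A i))
    (H : Set ((∀ i, A i) × (∀ i, A i))) : Prop :=
  H.Nonempty ∧ (∀ z ∈ H, ∀ z' ∈ H, Accessible0 κ U C z z') ∧
    (∀ z ∈ H, ∀ z', Accessible0 κ U C z z' → z' ∈ H)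

end PHPIP

section GeneralizedPolynomials

/-- `f` agrees on `(0, ∞)` with a finite linear combination of real powers. -/
def IsPowerSum (f : ℝ → ℝ) : Prop :=
  ∃ p : ℝ →₀ ℝ, ∀ x, 0 < x → f x = p.sum fun r c => c * x ^ r

namespace IsPowerSum

lemma monomial (c r : ℝ) : IsPowerSum fun x => c * x ^ r :=
  ⟨Finsupp.single r c, fun x _ => by simp⟩

lemma const (c : ℝ) : IsPowerSum fun _ => c := by
  simpa using monomial c 0

lemma rpow (r : ℝ) : IsPowerSum fun x => x ^ r := by
  simpa using monomial 1 r

lemma id : IsPowerSum fun x => x := by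
  simpa using rpow 1

lemma add {f g : ℝ → ℝ} (hf : IsPowerSum f) (hg : IsPowerSum g) :
    IsPowerSum fun x => f x + g x := by
  obtain ⟨p, hp⟩ := hf
  obtain ⟨q, hq⟩ := hg
  refine ⟨p + q, fun x hx => ?_⟩
  simp only [hp x hx, hq x hx]
  rw [Finsupp.sum_add_index'] <;> intros <;> ring

lemma sum {α : Type*} (s : Finset α) {f : α → ℝ → ℝ} (h : ∀ a ∈ s, IsPowerSum (f a)) :
    IsPowerSum fun x => ∑ a ∈ s, f a x := by
  induction s using Finset.induction_on with
  | empty => simpa using const 0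
  | insert a s ha ih =>
    simp only [Finset.sum_insert ha]
    exact (h a (by simp)).add (ih fun b hb => h b (by simp [hb]))

lemma mul {f g : ℝ → ℝ} (hf : IsPowerSum f) (hg : IsPowerSum g) :
    IsPowerSum fun x => f x * g x := by
  obtain ⟨p, hp⟩ := hf
  obtain ⟨q, hq⟩ := hg
  obtain ⟨w, hw⟩ := sum p.support (f := fun r x => ∑ s ∈ q.support, p r * q s * x ^ (r + s))
    fun r _ => sum q.support fun s _ => monomial (p r * q s) (r + s)
  refine ⟨w, fun x hx => ?_⟩
  rw [← hw x hx]
  simp only [hp x hx, hq x hx]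
  rw [Finsupp.sum, Finsupp.sum, Finset.sum_mul_sum]
  refine Finset.sum_congr rfl fun r _ => Finset.sum_congr rfl fun s _ => ?_
  rw [Real.rpow_add hx]
  ring

lemma sub {f g : ℝ → ℝ} (hf : IsPowerSum f) (hg : IsPowerSum g) :
    IsPowerSum fun x => f x - g x := by
  simpa [sub_eq_add_neg] using hf.add ((const (-1)).mul hg)

lemma prod {α : Type*} (s : Finset α) {f : α → ℝ → ℝ} (h : ∀ a ∈ s, IsPowerSum (f a)) :
    IsPowerSum fun x => ∏ a ∈ s, f a x := by
  induction s using Finset.induction_on with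
  | empty => simpa using const 1
  | insert a s ha ih =>
    simp only [Finset.prod_insert ha]
    exact (h a (by simp)).mul (ih fun b hb => h b (by simp [hb]))

lemma ite (p : Prop) [Decidable p] {f g : ℝ → ℝ} (hf : IsPowerSum f) (hg : IsPowerSum g) :
    IsPowerSum fun x => if p then f x else g x := by
  split_ifs <;> assumption

lemma det {n : Type*} [Fintype n] [DecidableEq n] {M : ℝ → Matrix n n ℝ}
    (h : ∀ i j, IsPowerSum fun x => M x i j) : IsPowerSum fun x => (M x).det := by
  simp only [Matrix.det_apply']
  exact sum _ fun σ _ => (const _).mul (prod _ fun i _ => h _ _)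

lemma adjugate {n : Type*} [Fintype n] [DecidableEq n] {M : ℝ → Matrix n n ℝ}
    (h : ∀ i j, IsPowerSum fun x => M x i j) (i j : n) :
    IsPowerSum fun x => (M x).adjugate i j := by
  simp only [Matrix.adjugate_apply]
  refine det fun a b => ?_
  by_cases hab : a = j
  · subst hab
    simpa using const _
  · simpa [Matrix.updateRow_apply, hab] using h a b

/-- A power sum has constant weak sign near `0`. -/
lemma eventually_sign {f : ℝ → ℝ} (hf : IsPowerSum f) :
    (∀ᶠ x in 𝓝[>] (0 : ℝ), 0 ≤ f x) ∨ (∀ᶠ x in 𝓝[>] (0 : ℝ), f x ≤ 0) := by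
  obtain ⟨p, hp⟩ := hf
  by_cases h0 : p.support.Nonempty
  swap
  · left
    filter_upwards [self_mem_nhdsWithin] with x hx
    simp [hp x hx, Finsupp.sum, Finset.not_nonempty_iff_eq_empty.1 h0]
  set m := p.support.min' h0 with hm
  have hmem : m ∈ p.support := p.support.min'_mem h0
  have hlim : Tendsto (fun x : ℝ => ∑ r ∈ p.support, p r * x ^ (r - m)) (𝓝[>] 0)
      (𝓝 (∑ r ∈ p.support, if r = m then p m else 0)) := by
    refine tendsto_finsetSum _ fun r hr => ?_
    split_ifs with h
    · simp [h]
    · have hlt : 0 < r - m := sub_pos.2 (lt_of_le_of_ne (p.support.min'_le r hr) (Ne.symm h))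
      have h1 : Tendsto (fun x : ℝ => x ^ (r - m)) (𝓝[>] 0) (𝓝 0) := by
        have := (Real.continuousAt_rpow_const 0 (r - m) (Or.inr hlt.le)).tendsto
        rw [Real.zero_rpow hlt.ne'] at this
        exact this.mono_left nhdsWithin_le_nhds
      simpa using h1.const_mul (p r)
  rw [Finset.sum_ite_eq' p.support m fun _ => p m, if_pos hmem] at hlim
  have hf : ∀ x, 0 < x → f x = x ^ m * ∑ r ∈ p.support, p r * x ^ (r - m) := by
    intro x hx
    rw [hp x hx, Finsupp.sum, Finset.mul_sum]
    refine Finset.sum_congr rfl fun r _ => ?_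
    rw [Real.rpow_sub hx]
    field_simp [(Real.rpow_pos_of_pos hx m).ne']
  rcases lt_or_gt_of_ne (Finsupp.mem_support_iff.1 hmem) with h | h
  · right
    filter_upwards [hlim.eventually (gt_mem_nhds h), self_mem_nhdsWithin] with x hx hx0
    rw [hf x hx0]
    exact mul_nonpos_of_nonneg_of_nonpos (Real.rpow_nonneg (le_of_lt hx0) _) hx.le
  · left
    filter_upwards [hlim.eventually (lt_mem_nhds h), self_mem_nhdsWithin] with x hx hx0
    rw [hf x hx0]
    exact mul_nonneg (Real.rpow_nonneg (le_of_lt hx0) _) hx.le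

lemma exists_hasDerivAt {f : ℝ → ℝ} (hf : IsPowerSum f) :
    ∃ f', IsPowerSum f' ∧ ∀ x, 0 < x → HasDerivAt f (f' x) x := by
  obtain ⟨p, hp⟩ := hf
  refine ⟨fun x => ∑ r ∈ p.support, p r * r * x ^ (r - 1),
    sum _ fun r _ => monomial _ _, fun x hx => ?_⟩
  have h : HasDerivAt (fun y : ℝ => ∑ r ∈ p.support, p r * y ^ r)
      (∑ r ∈ p.support, p r * (r * x ^ (r - 1))) x :=
    HasDerivAt.fun_sum fun r _ => (Real.hasDerivAt_rpow_const (Or.inl hx.ne')).const_mul _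
  simp only [mul_assoc]
  refine h.congr_of_eventuallyEq ?_
  filter_upwards [lt_mem_nhds hx] with y hy
  exact hp y hy

/-- A quotient of power sums is monotone or antitone near `0`. -/
lemma monotoneOn_or_antitoneOn_div {f g : ℝ → ℝ} (hf : IsPowerSum f) (hg : IsPowerSum g)
    {a : ℝ} (ha : 0 < a) (hg0 : ∀ x ∈ Set.Ioo 0 a, g x ≠ 0) :
    ∃ b, 0 < b ∧ (MonotoneOn (fun x => f x / g x) (Set.Ioo 0 b) ∨
      AntitoneOn (fun x => f x / g x) (Set.Ioo 0 b)) := by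
  obtain ⟨f', hf', hfd⟩ := hf.exists_hasDerivAt
  obtain ⟨g', hg', hgd⟩ := hg.exists_hasDerivAt
  have hd : ∀ x ∈ Set.Ioo 0 a, HasDerivAt (fun x => f x / g x)
      ((f' x * g x - f x * g' x) / g x ^ 2) x := fun x hx =>
    (hfd x hx.1).fun_div (hgd x hx.1) (hg0 x hx)
  have hsign := ((hf'.mul hg).sub (hf.mul hg')).eventually_sign
  have key : ∀ {Q : ℝ → Prop}, (∀ᶠ x in 𝓝[>] (0 : ℝ), Q x) →
      ∃ b, 0 < b ∧ b ≤ a ∧ ∀ x ∈ Set.Ioo 0 b, Q x := by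
    intro Q hQ
    obtain ⟨b, hb, hsub⟩ := mem_nhdsGT_iff_exists_Ioo_subset.1 hQ
    exact ⟨min a b, lt_min ha hb, min_le_left _ _, fun x hx =>
      hsub ⟨hx.1, hx.2.trans_le (min_le_right _ _)⟩⟩
  rcases hsign with h | h
  · obtain ⟨b, hb, hba, hQ⟩ := key h
    have hsub : ∀ x ∈ Set.Ioo 0 b, x ∈ Set.Ioo 0 a := fun x hx => ⟨hx.1, hx.2.trans_le hba⟩
    refine ⟨b, hb, Or.inl (monotoneOn_of_deriv_nonneg (convex_Ioo _ _)
      (fun x hx => (hd x (hsub x hx)).continuousAt.continuousWithinAt) ?_ ?_)⟩ <;>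
      rw [interior_Ioo] <;> intro x hx
    · exact (hd x (hsub x hx)).differentiableAt.differentiableWithinAt
    · rw [(hd x (hsub x hx)).deriv]
      exact div_nonneg (hQ x hx) (sq_nonneg _)
  · obtain ⟨b, hb, hba, hQ⟩ := key h
    have hsub : ∀ x ∈ Set.Ioo 0 b, x ∈ Set.Ioo 0 a := fun x hx => ⟨hx.1, hx.2.trans_le hba⟩
    refine ⟨b, hb, Or.inr (antitoneOn_of_deriv_nonpos (convex_Ioo _ _)
      (fun x hx => (hd x (hsub x hx)).continuousAt.continuousWithinAt) ?_ ?_)⟩ <;>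
      rw [interior_Ioo] <;> intro x hx
    · exact (hd x (hsub x hx)).differentiableAt.differentiableWithinAt
    · rw [(hd x (hsub x hx)).deriv]
      exact div_nonpos_of_nonpos_of_nonneg (hQ x hx) (sq_nonneg _)

end IsPowerSum

end GeneralizedPolynomials

section StochasticMatrices

open Matrix

variable {S : Type*} [Fintype S] [DecidableEq S]

/-- The product `P k * P (k + 1) * ⋯ * P (k + m - 1)`. -/
def matProd (P : ℕ → Matrix S S ℝ) (k : ℕ) : ℕ → Matrix S S ℝ
  | 0 => 1
  | m + 1 => matProd P k m * P (k + m)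

lemma matProd_add (P : ℕ → Matrix S S ℝ) (k a b : ℕ) :
    matProd P k (a + b) = matProd P k a * matProd P (k + a) b := by
  induction b with
  | zero => simp [matProd]
  | succ b ih => rw [← add_assoc, matProd, ih, matProd, Matrix.mul_assoc, add_assoc]

lemma matProd_mem_rowStochastic {P : ℕ → Matrix S S ℝ} {k : ℕ}
    (hP : ∀ j, k ≤ j → P j ∈ rowStochastic ℝ S) (m : ℕ) :
    matProd P k m ∈ rowStochastic ℝ S := by
  induction m with
  | zero => exact one_mem _
  | succ m ih => exact mul_mem ih (hP _ (by omega))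

lemma matProd_const (P : Matrix S S ℝ) (k l m : ℕ) :
    matProd (fun _ => P) k m = matProd (fun _ => P) l m := by
  induction m with
  | zero => rfl
  | succ m ih => rw [matProd, matProd, ih]

lemma sum_vecMul {M : Matrix S S ℝ} (hM : M ∈ rowStochastic ℝ S) (v : S → ℝ) :
    ∑ j, (v ᵥ* M) j = ∑ i, v i := by
  simp only [vecMul, dotProduct]
  rw [Finset.sum_comm]
  simp [← Finset.mul_sum, sum_row_of_mem_rowStochastic hM]

lemma sum_abs_vecMul_le {M : Matrix S S ℝ} (hM : M ∈ rowStochastic ℝ S) (v : S → ℝ) :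
    ∑ j, |(v ᵥ* M) j| ≤ ∑ i, |v i| := by
  calc ∑ j, |(v ᵥ* M) j| ≤ ∑ j, ∑ i, |v i| * M i j := by
        refine Finset.sum_le_sum fun j _ => (Finset.abs_sum_le_sum_abs _ _).trans_eq ?_
        exact Finset.sum_congr rfl fun i _ => by
          rw [abs_mul, abs_of_nonneg (nonneg_of_mem_rowStochastic hM)]
    _ = ∑ i, |v i| := by
        rw [Finset.sum_comm]
        simp [← Finset.mul_sum, sum_row_of_mem_rowStochastic hM]

/-- Doeblin contraction on vectors of total mass zero. -/
lemma sum_abs_vecMul_le_of_column {M : Matrix S S ℝ} (hM : M ∈ rowStochastic ℝ S) {b : S}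
    {δ : ℝ} (hδ : ∀ i, δ ≤ M i b) {v : S → ℝ} (hv : ∑ i, v i = 0) :
    ∑ j, |(v ᵥ* M) j| ≤ (1 - δ) * ∑ i, |v i| := by
  have hN : ∀ i j, 0 ≤ M i j - if j = b then δ else 0 := by
    intro i j
    split_ifs with h
    · subst h; linarith [hδ i]
    · simpa using nonneg_of_mem_rowStochastic hM
  calc ∑ j, |(v ᵥ* M) j| ≤ ∑ j, ∑ i, |v i| * (M i j - if j = b then δ else 0) := by
        refine Finset.sum_le_sum fun j _ => ?_
        have : (v ᵥ* M) j = ∑ i, v i * (M i j - if j = b then δ else 0) := by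
          simp only [mul_sub, Finset.sum_sub_distrib, ← Finset.sum_mul, hv]
          simp [vecMul, dotProduct]
        rw [this]
        refine (Finset.abs_sum_le_sum_abs _ _).trans_eq ?_
        exact Finset.sum_congr rfl fun i _ => by rw [abs_mul, abs_of_nonneg (hN i j)]
    _ = (1 - δ) * ∑ i, |v i| := by
        rw [Finset.sum_comm]
        simp [← Finset.mul_sum, sum_row_of_mem_rowStochastic hM, ← Finset.sum_mul, mul_comm]

/-- Weak ergodicity: if the blocks of length `T` have a column bounded below by `δ` with
divergent sum, then mass-zero vectors are contracted to zero. -/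
lemma tendsto_sum_abs_vecMul_matProd {P : ℕ → Matrix S S ℝ} {k T : ℕ} (hT : 0 < T)
    (hP : ∀ j, k ≤ j → P j ∈ rowStochastic ℝ S) {b : S} {δ : ℕ → ℝ}
    (hδ : ∀ l i, δ l ≤ matProd P (k + l * T) T i b)
    (hdiv : Tendsto (fun J => ∑ l ∈ Finset.range J, δ l) atTop atTop)
    {v : S → ℝ} (hv : ∑ i, v i = 0) :
    Tendsto (fun m => ∑ j, |(v ᵥ* matProd P k m) j|) atTop (𝓝 0) := by
  set n1 : ℕ → ℝ := fun m => ∑ j, |(v ᵥ* matProd P k m) j| with hn1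
  have hnonneg : ∀ m, 0 ≤ n1 m := fun m => Finset.sum_nonneg fun _ _ => abs_nonneg _
  have hanti : Antitone n1 := antitone_nat_of_succ_le fun m => by
    simp only [hn1, matProd, ← vecMul_vecMul]
    exact sum_abs_vecMul_le (hP _ (by omega)) _
  have hblock : ∀ J, n1 (J * T) ≤ Real.exp (-∑ l ∈ Finset.range J, δ l) * n1 0 := by
    intro J
    induction J with
    | zero => simp
    | succ J ih =>
      have h0 : ∑ j, (v ᵥ* matProd P k (J * T)) j = 0 := by
        rw [sum_vecMul (matProd_mem_rowStochastic hP _), hv]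
      have h1 : n1 ((J + 1) * T) ≤ (1 - δ J) * n1 (J * T) := by
        simp only [hn1, Nat.succ_mul, matProd_add, ← vecMul_vecMul]
        exact sum_abs_vecMul_le_of_column
          (matProd_mem_rowStochastic (fun j hj => hP j (by omega)) _) (hδ J) h0
      calc n1 ((J + 1) * T) ≤ (1 - δ J) * n1 (J * T) := h1
        _ ≤ Real.exp (-δ J) * n1 (J * T) := by
            refine mul_le_mul_of_nonneg_right ?_ (hnonneg _)
            linarith [Real.add_one_le_exp (-δ J)]
        _ ≤ Real.exp (-δ J) * (Real.exp (-∑ l ∈ Finset.range J, δ l) * n1 0) := by gcongr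
        _ = _ := by rw [Finset.sum_range_succ, neg_add, Real.exp_add]; ring
  have hlim : Tendsto (fun J => n1 (J * T)) atTop (𝓝 0) := by
    refine squeeze_zero (fun J => hnonneg _) hblock ?_
    have := (Real.tendsto_exp_neg_atTop_nhds_zero.comp hdiv).mul_const (n1 0)
    simpa using this
  refine squeeze_zero hnonneg (fun m => hanti (Nat.div_mul_le_self m T))
    (hlim.comp (Nat.tendsto_div_const_atTop hT.ne'))

/-- The matrix whose inverse encodes the stationary distribution of `P`. -/
def stationaryMatrix (P : Matrix S S ℝ) : Matrix S S ℝ := 1 - P + Matrix.of fun _ _ => 1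

/-- The stationary distribution of `P`, when it is unique. -/
noncomputable def stationary (P : Matrix S S ℝ) : S → ℝ :=
  (fun _ => 1) ᵥ* (stationaryMatrix P)⁻¹

lemma vecMul_stationaryMatrix (P : Matrix S S ℝ) (v : S → ℝ) :
    v ᵥ* stationaryMatrix P = v - v ᵥ* P + fun _ => ∑ i, v i := by
  rw [stationaryMatrix, vecMul_add, vecMul_sub, vecMul_one]
  congr 1
  ext j
  simp [vecMul, dotProduct]

lemma sum_vecMul_stationaryMatrix {P : Matrix S S ℝ} (hP : P ∈ rowStochastic ℝ S)
    (v : S → ℝ) : ∑ j, (v ᵥ* stationaryMatrix P) j = Fintype.card S * ∑ i, v i := by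
  rw [vecMul_stationaryMatrix]
  simp [Finset.sum_add_distrib, sum_vecMul hP]

variable {P : Matrix S S ℝ} (hP : P ∈ rowStochastic ℝ S) {b : S} {T : ℕ} (hT : 0 < T) {δ : ℝ}
  (hδ0 : 0 < δ) (hδ : ∀ i, δ ≤ matProd (fun _ => P) 0 T i b)

include hP hT hδ0 hδ

lemma tendsto_sum_abs_vecMul_matProd_const {v : S → ℝ} (hv : ∑ i, v i = 0) :
    Tendsto (fun m => ∑ j, |(v ᵥ* matProd (fun _ => P) 0 m) j|) atTop (𝓝 0) := by
  refine tendsto_sum_abs_vecMul_matProd hT (fun _ _ => hP) (b := b) (δ := fun _ => δ)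
    (fun l i => ?_) ?_ hv
  · rw [matProd_const P _ 0]
    exact hδ i
  · simpa using tendsto_natCast_atTop_atTop.atTop_mul_const hδ0

lemma isUnit_det_stationaryMatrix : IsUnit (stationaryMatrix P).det := by
  rw [isUnit_iff_ne_zero]
  intro hdet
  obtain ⟨v, hv0, hv⟩ := exists_vecMul_eq_zero_iff.2 hdet
  have hS : (Fintype.card S : ℝ) ≠ 0 := by
    have : Nonempty S := ⟨b⟩
    exact_mod_cast Fintype.card_ne_zero
  have hsum : ∑ i, v i = 0 := by
    have := sum_vecMul_stationaryMatrix hP v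
    rw [hv] at this
    simpa [hS] using this.symm
  have hfix : v ᵥ* P = v := by
    have := vecMul_stationaryMatrix P v
    rw [hv, hsum] at this
    ext j
    have := congrFun this j
    simp at this
    linarith
  have hfix' : ∀ m, v ᵥ* matProd (fun _ => P) 0 m = v := by
    intro m
    induction m with
    | zero => simp [matProd]
    | succ m ih => rw [matProd, ← vecMul_vecMul, ih, hfix]
  have hlim := tendsto_sum_abs_vecMul_matProd_const hP hT hδ0 hδ hsum
  simp only [hfix'] at hlim
  have h0 := tendsto_nhds_unique hlim tendsto_const_nhds
  apply hv0
  ext j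
  have := (Finset.sum_eq_zero_iff_of_nonneg fun i _ => abs_nonneg (v i)).1 h0.symm j
    (Finset.mem_univ j)
  simpa using this

lemma stationary_vecMul_stationaryMatrix :
    stationary P ᵥ* stationaryMatrix P = fun _ => 1 := by
  rw [stationary, vecMul_vecMul, nonsing_inv_mul _ (isUnit_det_stationaryMatrix hP hT hδ0 hδ),
    vecMul_one]

lemma sum_stationary : ∑ i, stationary P i = 1 := by
  have h := sum_vecMul_stationaryMatrix hP (stationary P)
  rw [stationary_vecMul_stationaryMatrix hP hT hδ0 hδ] at h
  have hS : (Fintype.card S : ℝ) ≠ 0 := by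
    have : Nonempty S := ⟨b⟩
    exact_mod_cast Fintype.card_ne_zero
  simpa [hS] using h.symm

lemma stationary_vecMul : stationary P ᵥ* P = stationary P := by
  have h := vecMul_stationaryMatrix P (stationary P)
  rw [stationary_vecMul_stationaryMatrix hP hT hδ0 hδ, sum_stationary hP hT hδ0 hδ] at h
  ext j
  have := congrFun h j
  simp at this
  linarith

lemma tendsto_matProd_stationary (j : S) :
    Tendsto (fun m => matProd (fun _ => P) 0 m b j) atTop (𝓝 (stationary P j)) := by
  have hfix : ∀ m, stationary P ᵥ* matProd (fun _ => P) 0 m = stationary P := by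
    intro m
    induction m with
    | zero => simp [matProd]
    | succ m ih => rw [matProd, ← vecMul_vecMul, ih, stationary_vecMul hP hT hδ0 hδ]
  have hlim := tendsto_sum_abs_vecMul_matProd_const hP hT hδ0 hδ
    (v := Pi.single b 1 - stationary P) (by simp [sum_stationary hP hT hδ0 hδ])
  rw [tendsto_iff_dist_tendsto_zero]
  refine squeeze_zero (fun _ => dist_nonneg) (fun m => ?_) hlim
  refine le_trans (le_of_eq ?_) (Finset.single_le_sum (fun i _ => abs_nonneg _)
    (Finset.mem_univ j))
  rw [Real.dist_eq, sub_vecMul, hfix, single_one_vecMul]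
  rfl

lemma stationary_nonneg (j : S) : 0 ≤ stationary P j :=
  ge_of_tendsto' (tendsto_matProd_stationary hP hT hδ0 hδ j) fun m =>
    nonneg_of_mem_rowStochastic (matProd_mem_rowStochastic (fun _ _ => hP) m)

lemma stationary_eq_zero {X : Set S} (hb : b ∈ X) (hX : ∀ i ∈ X, ∀ j ∉ X, P i j = 0) {j : S}
    (hj : j ∉ X) : stationary P j = 0 := by
  refine tendsto_nhds_unique (tendsto_matProd_stationary hP hT hδ0 hδ j)
    (tendsto_const_nhds.congr fun m => ?_)
  induction m generalizing j with
  | zero => simp [matProd, show b ≠ j by rintro rfl; exact hj hb]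
  | succ m ih =>
    rw [matProd, mul_apply, eq_comm]
    refine Finset.sum_eq_zero fun i _ => ?_
    by_cases hi : i ∈ X
    · rw [hX i hi j hj, mul_zero]
    · rw [← ih hi, zero_mul]

end StochasticMatrices

section Annealing

open Matrix

variable {S : Type*} [Fintype S] [DecidableEq S]

lemma abs_sub_add_abs_sub_of_monotone_or_antitone {u : ℕ → ℝ} (hu : Monotone u ∨ Antitone u)
    (m : ℕ) : |u m - u 0| + |u (m + 1) - u m| = |u (m + 1) - u 0| := by
  rcases hu with h | h
  · have h1 := h (Nat.zero_le m)
    have h2 := h (Nat.le_succ m)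
    rw [abs_of_nonneg, abs_of_nonneg, abs_of_nonneg] <;> simp at * <;> linarith
  · have h1 := h (Nat.zero_le m)
    have h2 := h (Nat.le_succ m)
    rw [abs_of_nonpos, abs_of_nonpos, abs_of_nonpos] <;> simp at * <;> linarith

/-- Tracking error of an inhomogeneous chain with respect to a coordinatewise monotone sequence of
stationary distributions. -/
lemma sum_abs_vecMul_matProd_sub_le {P : ℕ → Matrix S S ℝ} {μ : ℕ → S → ℝ} {k : ℕ}
    (hP : ∀ j, k ≤ j → P j ∈ rowStochastic ℝ S) (hμ : ∀ j, k ≤ j → μ j ᵥ* P j = μ j)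
    (hmono : ∀ z, Monotone (fun m => μ (k + m) z) ∨ Antitone (fun m => μ (k + m) z))
    (q : S → ℝ) (m : ℕ) :
    ∑ z, |(q ᵥ* matProd P k m) z - μ (k + m) z| ≤
      ∑ z, |((q - μ k) ᵥ* matProd P k m) z| + ∑ z, |μ (k + m) z - μ k z| := by
  have key : ∀ m, ∑ z, |(μ k ᵥ* matProd P k m - μ (k + m)) z| ≤
      ∑ z, |μ (k + m) z - μ k z| := by
    intro m
    induction m with
    | zero => simp [matProd]
    | succ m ih =>
      have hstep : μ k ᵥ* matProd P k (m + 1) - μ (k + (m + 1)) =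
          (μ k ᵥ* matProd P k m - μ (k + m)) ᵥ* P (k + m) - (μ (k + (m + 1)) - μ (k + m)) := by
        rw [matProd, ← vecMul_vecMul, sub_vecMul, hμ (k + m) (by omega)]
        abel
      rw [hstep]
      calc _ ≤ ∑ z, (|((μ k ᵥ* matProd P k m - μ (k + m)) ᵥ* P (k + m)) z| +
              |μ (k + (m + 1)) z - μ (k + m) z|) := Finset.sum_le_sum fun z _ => abs_sub _ _
        _ ≤ ∑ z, |μ (k + m) z - μ k z| + ∑ z, |μ (k + (m + 1)) z - μ (k + m) z| := by
            rw [Finset.sum_add_distrib]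
            exact add_le_add_left ((sum_abs_vecMul_le (hP (k + m) (by omega)) _).trans ih) _
        _ = _ := by
            rw [← Finset.sum_add_distrib]
            exact Finset.sum_congr rfl fun z _ =>
              abs_sub_add_abs_sub_of_monotone_or_antitone (hmono z) m
  have hdec : ∀ z, (q ᵥ* matProd P k m) z - μ (k + m) z =
      ((q - μ k) ᵥ* matProd P k m) z + (μ k ᵥ* matProd P k m - μ (k + m)) z := by
    intro z
    simp [sub_vecMul]
  calc _ ≤ ∑ z, (|((q - μ k) ᵥ* matProd P k m) z| +
          |(μ k ᵥ* matProd P k m - μ (k + m)) z|) :=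
        Finset.sum_le_sum fun z _ => by rw [hdec]; exact abs_add_le _ _
    _ ≤ _ := by
        rw [Finset.sum_add_distrib]
        exact add_le_add_right (key m) _

lemma IsPowerSum.stationary_monotone {P : ℝ → Matrix S S ℝ}
    (hP : ∀ i j, IsPowerSum fun x => P x i j)
    {a : ℝ} (ha : 0 < a) (hdet : ∀ x ∈ Set.Ioo 0 a, IsUnit (stationaryMatrix (P x)).det) (z : S) :
    ∃ b, 0 < b ∧ (MonotoneOn (fun x => stationary (P x) z) (Set.Ioo 0 b) ∨
      AntitoneOn (fun x => stationary (P x) z) (Set.Ioo 0 b)) := by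
  have hM : ∀ i j, IsPowerSum fun x => stationaryMatrix (P x) i j := by
    intro i j
    simp only [stationaryMatrix, Matrix.add_apply, Matrix.sub_apply, Matrix.of_apply]
    exact ((IsPowerSum.const _).sub (hP i j)).add (IsPowerSum.const 1)
  have hnum : IsPowerSum fun x => ∑ i, (stationaryMatrix (P x)).adjugate i z :=
    IsPowerSum.sum _ fun i _ => IsPowerSum.adjugate hM i z
  have heq : ∀ x, stationary (P x) z =
      (∑ i, (stationaryMatrix (P x)).adjugate i z) / (stationaryMatrix (P x)).det := by
    intro x
    simp [stationary, vecMul, dotProduct, Matrix.inv_def, ← Finset.mul_sum, div_eq_inv_mul]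
  simp only [heq]
  exact hnum.monotoneOn_or_antitoneOn_div (IsPowerSum.det hM) ha fun x hx => (hdet x hx).ne_zero

lemma tendsto_nat_rpow_neg_inv {N : ℝ} (hN : 0 < N) :
    Tendsto (fun k : ℕ => (k : ℝ) ^ (-1 / N)) atTop (𝓝[>] 0) := by
  rw [tendsto_nhdsWithin_iff]
  constructor
  · have := (tendsto_rpow_neg_atTop (one_div_pos.2 hN)).comp tendsto_natCast_atTop_atTop
    simpa [Function.comp_def, neg_div] using this
  · filter_upwards [eventually_gt_atTop 0] with k hk
    exact Real.rpow_pos_of_pos (by exact_mod_cast hk) _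

/-- Simulated annealing with cooling schedule `k ^ (-1 / N)`: states that are negligible
under the stationary distributions are asymptotically never occupied. -/
theorem tendsto_matProd_annealing {P : ℝ → Matrix S S ℝ}
    (hst : ∀ x, 0 < x → x ≤ 1 → P x ∈ rowStochastic ℝ S)
    (hps : ∀ i j, IsPowerSum fun x => P x i j) {b : S} {T : ℕ} (hT : 0 < T) {N c : ℝ} (hN : 0 < N)
    (hc : 0 < c)
    (hD : ∀ (ε : ℕ → ℝ) (k : ℕ) (e : ℝ), 0 < e → (∀ j < T, e ≤ ε (k + j) ∧ ε (k + j) ≤ 1 / 2) →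
      ∀ i, c * e ^ N ≤ matProd (fun j => P (ε j)) k T i b)
    {z : S} (hz : Tendsto (fun x => stationary (P x) z) (𝓝[>] 0) (𝓝 0)) (z0 : S) {k0 : ℕ}
    (hk0 : 1 ≤ k0) :
    Tendsto (fun m => matProd (fun k : ℕ => P ((k : ℝ) ^ (-1 / N))) k0 m z0 z) atTop (𝓝 0) := by
  set ε : ℕ → ℝ := fun k => (k : ℝ) ^ (-1 / N) with hε
  have hεlim : Tendsto ε atTop (𝓝[>] 0) := tendsto_nat_rpow_neg_inv hN
  have hεpos : ∀ k, 1 ≤ k → 0 < ε k := fun k hk => Real.rpow_pos_of_pos (by exact_mod_cast hk) _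
  have hεanti : ∀ k l, 1 ≤ k → k ≤ l → ε l ≤ ε k := fun k l hk hkl =>
    Real.rpow_le_rpow_of_nonpos (by exact_mod_cast hk) (by exact_mod_cast hkl)
      (div_nonpos_of_nonpos_of_nonneg (by norm_num) hN.le)
  have hεone : ∀ k, 1 ≤ k → ε k ≤ 1 := fun k hk => by
    simpa [hε] using hεanti 1 k le_rfl hk
  have hεpow : ∀ k, 1 ≤ k → ε k ^ N = 1 / k := fun k hk => by
    simp only [hε]
    rw [← Real.rpow_mul (Nat.cast_nonneg k), div_mul_cancel₀ _ hN.ne', Real.rpow_neg_one, one_div]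
  have hcol : ∀ x, 0 < x → x ≤ 1 / 2 → ∀ i, c * x ^ N ≤ matProd (fun _ => P x) 0 T i b :=
    fun x h0 h1 => hD (fun _ => x) 0 x h0 fun _ _ => ⟨le_rfl, h1⟩
  have hcpos : ∀ x, 0 < x → 0 < c * x ^ N := fun x hx => mul_pos hc (Real.rpow_pos_of_pos hx _)
  have hstat : ∀ x, 0 < x → x ≤ 1 / 2 → stationary (P x) ᵥ* P x = stationary (P x) :=
    fun x h0 h1 => stationary_vecMul (hst x h0 (by linarith)) hT (hcpos x h0) (hcol x h0 h1)
  have hsum : ∀ x, 0 < x → x ≤ 1 / 2 → ∑ i, stationary (P x) i = 1 :=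
    fun x h0 h1 => sum_stationary (hst x h0 (by linarith)) hT (hcpos x h0) (hcol x h0 h1)
  have hnn : ∀ x, 0 < x → x ≤ 1 / 2 → ∀ i, 0 ≤ stationary (P x) i :=
    fun x h0 h1 => stationary_nonneg (hst x h0 (by linarith)) hT (hcpos x h0) (hcol x h0 h1)
  have hle : ∀ x, 0 < x → x ≤ 1 / 2 → ∀ i, stationary (P x) i ≤ 1 := fun x h0 h1 i => by
    rw [← hsum x h0 h1]
    exact Finset.single_le_sum (fun j _ => hnn x h0 h1 j) (Finset.mem_univ i)
  choose a ha0 ha using fun i => IsPowerSum.stationary_monotone hps (a := 1 / 2) (by norm_num)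
    (fun x hx => isUnit_det_stationaryMatrix (hst x hx.1 (by linarith [hx.2])) hT (hcpos x hx.1)
      (hcol x hx.1 hx.2.le)) i
  obtain ⟨K, hK0, hKhalf, hKa⟩ : ∃ K, k0 ≤ K ∧ (∀ k, K ≤ k → ε k ≤ 1 / 2) ∧
      ∀ i k, K ≤ k → ε k < a i := by
    have h1 : ∀ᶠ k in atTop, ε k < 1 / 2 :=
      (hεlim.mono_right nhdsWithin_le_nhds).eventually (gt_mem_nhds (by norm_num))
    have h2 : ∀ᶠ k in atTop, ∀ i, ε k < a i := eventually_all.2 fun i =>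
      (hεlim.mono_right nhdsWithin_le_nhds).eventually (gt_mem_nhds (ha0 i))
    obtain ⟨K, hK⟩ := eventually_atTop.1 (h1.and h2)
    exact ⟨max k0 K, le_max_left _ _, fun k hk => (hK k (le_of_max_le_right hk)).1.le,
      fun i k hk => (hK k (le_of_max_le_right hk)).2 i⟩
  set μ : ℕ → S → ℝ := fun k => stationary (P (ε k)) with hμ
  have hmono : ∀ l, K ≤ l → ∀ i, Monotone (fun m => μ (l + m) i) ∨
      Antitone (fun m => μ (l + m) i) := by
    intro l hl i
    have hmem : ∀ m, ε (l + m) ∈ Set.Ioo 0 (a i) := fun m =>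
      ⟨hεpos _ (by omega), hKa i _ (by omega)⟩
    have hle : ∀ m m', m ≤ m' → ε (l + m') ≤ ε (l + m) := fun m m' h =>
      hεanti _ _ (by omega) (by omega)
    rcases ha i with h | h
    · exact Or.inr fun m m' hm => h (hmem _) (hmem _) (hle _ _ hm)
    · exact Or.inl fun m m' hm => h (hmem _) (hmem _) (hle _ _ hm)
  have hstoch : ∀ k, 1 ≤ k → P (ε k) ∈ rowStochastic ℝ S := fun k hk =>
    hst _ (hεpos k hk) (hεone k hk)
  have hconv : ∀ i, ∃ L, Tendsto (fun m => μ (K + m) i) atTop (𝓝 L) := by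
    intro i
    have hlo : ∀ m, 0 ≤ μ (K + m) i := fun m =>
      hnn _ (hεpos _ (by omega)) (hKhalf _ (by omega)) i
    have hhi : ∀ m, μ (K + m) i ≤ 1 := fun m =>
      hle _ (hεpos _ (by omega)) (hKhalf _ (by omega)) i
    rcases hmono K le_rfl i with h | h
    · exact ⟨_, tendsto_atTop_ciSup h ⟨1, by rintro _ ⟨m, rfl⟩; exact hhi m⟩⟩
    · exact ⟨_, tendsto_atTop_ciInf h ⟨0, by rintro _ ⟨m, rfl⟩; exact hlo m⟩⟩
  choose L hL using hconv
  have hLsum : Tendsto (fun m => ∑ i, |μ (K + m) i - L i|) atTop (𝓝 0) := by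
    have : Tendsto (fun m => ∑ i, |μ (K + m) i - L i|) atTop (𝓝 (∑ i, |L i - L i|)) :=
      tendsto_finsetSum _ fun i _ => ((hL i).sub_const _).abs
    simpa using this
  have hweak : ∀ l, K ≤ l → ∀ v : S → ℝ, ∑ i, v i = 0 →
      Tendsto (fun m => ∑ j, |(v ᵥ* matProd (fun k => P (ε k)) l m) j|) atTop (𝓝 0) := by
    intro l hl v hv
    refine tendsto_sum_abs_vecMul_matProd hT (b := b) (fun j hj => hstoch j (by omega))
      (δ := fun n => c / (l + T : ℝ) * (1 / (n + 1 : ℝ))) (fun n i => ?_) ?_ hv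
    · refine le_trans ?_ (hD ε (l + n * T) (ε (l + n * T + T)) (hεpos _ (by omega))
        (fun j hj => ⟨hεanti _ _ (by omega) (by omega), hKhalf _ (by omega)⟩) i)
      rw [hεpow _ (by omega), div_mul_div_comm, mul_one, ← mul_one_div]
      gcongr
      have : 0 ≤ l * n := by positivity
      exact_mod_cast (by nlinarith : l + n * T + T ≤ (l + T) * (n + 1))
    · simp only [← Finset.mul_sum]
      refine Tendsto.const_mul_atTop (by positivity) ?_
      exact Real.tendsto_sum_range_one_div_nat_succ_atTop
  have hzlim : Tendsto (fun m => μ (K + m) z) atTop (𝓝 0) :=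
    (hz.comp hεlim).comp (tendsto_add_atTop_nat K |>.congr fun m => add_comm m K)
  have hQ : Tendsto (fun m => matProd (fun k => P (ε k)) k0 (K - k0 + m) z0 z) atTop (𝓝 0) := by
    rw [Metric.tendsto_atTop]
    intro η hη
    obtain ⟨l, hl⟩ := Metric.tendsto_atTop.1 hLsum (η / 5) (by positivity)
    have hl' : ∀ m, l ≤ m → ∑ i, |μ (K + m) i - L i| < η / 5 := fun m hm => by
      have := hl m hm
      rwa [Real.dist_eq, sub_zero, abs_of_nonneg (Finset.sum_nonneg fun _ _ => abs_nonneg _)]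
        at this
    set q : S → ℝ := fun i => matProd (fun k => P (ε k)) k0 (K - k0 + l) z0 i with hq
    have hqsum : ∑ i, q i = 1 := sum_row_of_mem_rowStochastic
      (matProd_mem_rowStochastic (fun j hj => hstoch j (by omega)) _) z0
    have hzero : ∑ i, (q - μ (K + l)) i = 0 := by
      simp [hqsum, hμ, hsum _ (hεpos (K + l) (by omega)) (hKhalf _ (by omega))]
    obtain ⟨M1, hM1⟩ := Metric.tendsto_atTop.1 (hweak (K + l) (by omega) _ hzero) (η / 5)
      (by positivity)
    obtain ⟨M2, hM2⟩ := Metric.tendsto_atTop.1 hzlim (η / 5) (by positivity)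
    refine ⟨l + M1 + M2, fun m hm => ?_⟩
    obtain ⟨m', rfl⟩ : ∃ m', m = l + m' := ⟨m - l, by omega⟩
    have hrow : matProd (fun k => P (ε k)) k0 (K - k0 + (l + m')) z0 z =
        (q ᵥ* matProd (fun k => P (ε k)) (K + l) m') z := by
      rw [← add_assoc, matProd_add, show k0 + (K - k0 + l) = K + l by omega]
      rfl
    have htrack := sum_abs_vecMul_matProd_sub_le (P := fun k => P (ε k)) (μ := μ) (k := K + l)
      (fun j hj => hstoch j (by omega))
      (fun j hj => hstat _ (hεpos _ (by omega)) (hKhalf _ (by omega)))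
      (hmono (K + l) (by omega)) q m'
    have h1 := hM1 m' (by omega)
    rw [Real.dist_eq, sub_zero, abs_of_nonneg (Finset.sum_nonneg fun _ _ => abs_nonneg _)] at h1
    have h2 := hM2 (l + m') (by omega)
    rw [← add_assoc, Real.dist_eq, sub_zero] at h2
    have h3 : ∑ i, |μ (K + l + m') i - μ (K + l) i| < 2 * (η / 5) := by
      have ha := hl' (l + m') (by omega)
      have hb := hl' l le_rfl
      rw [← add_assoc] at ha
      calc _ ≤ ∑ i, (|μ (K + l + m') i - L i| + |μ (K + l) i - L i|) :=
            Finset.sum_le_sum fun i _ => by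
              rw [abs_sub_comm (μ (K + l) i)]
              exact abs_sub_le _ _ _
        _ < _ := by rw [Finset.sum_add_distrib]; linarith
    have h4 : |(q ᵥ* matProd (fun k => P (ε k)) (K + l) m') z - μ (K + l + m') z| ≤
        ∑ i, |(q ᵥ* matProd (fun k => P (ε k)) (K + l) m') i - μ (K + l + m') i| :=
      Finset.single_le_sum
        (f := fun i => |(q ᵥ* matProd (fun k => P (ε k)) (K + l) m') i - μ (K + l + m') i|)
        (fun i _ => abs_nonneg _) (Finset.mem_univ z)
    rw [hrow, Real.dist_eq, sub_zero]
    have h5 := abs_sub_abs_le_abs_sub ((q ᵥ* matProd (fun k => P (ε k)) (K + l) m') z)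
      (μ (K + l + m') z)
    linarith
  refine (tendsto_add_atTop_iff_nat (K - k0)).1 (hQ.congr fun m => ?_)
  rw [add_comm]

end Annealing

section CostPaths

open Matrix

variable {S : Type*}

/-- `CostPath Step r x t c y`: there is a path of `t` steps from `x` to `y` of total cost `c`. -/
inductive CostPath (Step : S → S → Prop) (r : S → S → ℝ) (x : S) : ℕ → ℝ → S → Prop
  | refl : CostPath Step r x 0 0 x
  | snoc {t : ℕ} {c : ℝ} {y z : S} : CostPath Step r x t c y → Step y z →
      CostPath Step r x (t + 1) (c + r y z) z

variable {Step : S → S → Prop} {r : S → S → ℝ}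

lemma CostPath.trans {x y z : S} {t t' : ℕ} {c c' : ℝ} (h : CostPath Step r x t c y)
    (h' : CostPath Step r y t' c' z) : CostPath Step r x (t + t') (c + c') z := by
  induction h' with
  | refl => simpa using h
  | snoc _ hs ih => rw [← add_assoc, ← add_assoc]; exact ih.snoc hs

lemma CostPath.single {x y : S} (h : Step x y) : CostPath Step r x 1 (r x y) y := by
  simpa using CostPath.refl.snoc h

lemma CostPath.cost_nonneg (hr : ∀ y z, 0 ≤ r y z) {x y : S} {t : ℕ} {c : ℝ}
    (h : CostPath Step r x t c y) : 0 ≤ c := by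
  induction h with
  | refl => exact le_rfl
  | snoc _ _ ih => exact add_nonneg ih (hr _ _)

lemma CostPath.le_matProd [Fintype S] [DecidableEq S] {P : ℝ → Matrix S S ℝ} {c₀ : ℝ}
    (hc₀ : 0 ≤ c₀) (hr : ∀ y z, 0 ≤ r y z)
    (hnn : ∀ x, 0 < x → x ≤ 1 / 2 → ∀ y z, 0 ≤ P x y z)
    (hlow : ∀ x, 0 < x → x ≤ 1 / 2 → ∀ y z, Step y z → c₀ * x ^ r y z ≤ P x y z)
    {ε : ℕ → ℝ} {k : ℕ} {e : ℝ} (he : 0 < e) {x y : S} {t : ℕ} {c : ℝ}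
    (h : CostPath Step r x t c y) (hε : ∀ j < t, e ≤ ε (k + j) ∧ ε (k + j) ≤ 1 / 2) :
    c₀ ^ t * e ^ c ≤ matProd (fun j => P (ε j)) k t x y := by
  have hpos : ∀ j, e ≤ ε (k + j) → 0 < ε (k + j) := fun j hj => he.trans_le hj
  have hmat : ∀ t, (∀ j < t, e ≤ ε (k + j) ∧ ε (k + j) ≤ 1 / 2) →
      ∀ a b, 0 ≤ matProd (fun j => P (ε j)) k t a b := by
    intro t
    induction t with
    | zero =>
      intro _ a b
      simp only [matProd, Matrix.one_apply]
      split_ifs <;> norm_num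
    | succ t ih =>
      intro hε a b
      rw [matProd, mul_apply]
      exact Finset.sum_nonneg fun i _ => mul_nonneg (ih (fun j hj => hε j (by omega)) _ _)
        (hnn _ (hpos _ (hε t (by omega)).1) (hε t (by omega)).2 _ _)
  induction h with
  | refl => simp [matProd]
  | @snoc t c y z _ hs ih =>
    have hε' : ∀ j < t, e ≤ ε (k + j) ∧ ε (k + j) ≤ 1 / 2 := fun j hj => hε j (by omega)
    obtain ⟨h1, h2⟩ := hε t (by omega)
    rw [matProd, mul_apply, Real.rpow_add he, pow_succ]
    calc c₀ ^ t * c₀ * (e ^ c * e ^ r y z) = (c₀ ^ t * e ^ c) * (c₀ * e ^ r y z) := by ring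
      _ ≤ matProd (fun j => P (ε j)) k t x y * P (ε (k + t)) y z := by
          refine mul_le_mul (ih hε') (le_trans ?_ (hlow _ (hpos _ h1) h2 _ _ hs))
            (by positivity) (hmat t hε' _ _)
          exact mul_le_mul_of_nonneg_left (Real.rpow_le_rpow he.le h1 (hr _ _)) hc₀
      _ ≤ _ := Finset.single_le_sum
          (f := fun i => matProd (fun j => P (ε j)) k t x i * P (ε (k + t)) i z)
          (fun i _ => mul_nonneg (hmat t hε' _ _) (hnn _ (hpos _ h1) h2 _ _)) (Finset.mem_univ y)

variable {α : Type*} (d : α → S) (h : α → ℝ)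

/-- Values at `z` of paths started from a base point `d a` with initial height `h a`. -/
def pathValues (Step : S → S → Prop) (r : S → S → ℝ) (d : α → S) (h : α → ℝ) (z : S) : Set ℝ :=
  {v | ∃ a t c, CostPath Step r (d a) t c z ∧ v = h a + c}

open scoped Pointwise in
lemma exists_isLeast_pathValues [Finite S] [Finite α] (hr : ∀ y z, 0 ≤ r y z) :
    ∃ V : S → ℝ, ∀ z, (pathValues Step r d h z).Nonempty →
      IsLeast (pathValues Step r d h z) (V z) := by
  have hpwo : (Set.range h + (AddSubmonoid.closure
      (Set.range fun p : S × S => r p.1 p.2) : Set ℝ)).IsPWO :=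
    (Set.finite_range h).isPWO.add (Set.IsPWO.addSubmonoid_closure
      (by rintro _ ⟨p, rfl⟩; exact hr _ _) (Set.finite_range _).isPWO)
  have hsub : ∀ z, pathValues Step r d h z ⊆ Set.range h + (AddSubmonoid.closure
      (Set.range fun p : S × S => r p.1 p.2) : Set ℝ) := by
    rintro z _ ⟨a, t, c, hp, rfl⟩
    refine Set.add_mem_add ⟨a, rfl⟩ ?_
    induction hp with
    | refl => exact zero_mem _
    | @snoc t c y z _ _ ih =>
      exact add_mem ih (AddSubmonoid.subset_closure ⟨(y, z), rfl⟩)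
  have hex : ∀ z, ∃ v, (pathValues Step r d h z).Nonempty →
      IsLeast (pathValues Step r d h z) v := by
    intro z
    by_cases hz : (pathValues Step r d h z).Nonempty
    · have hwf := (hpwo.mono (hsub z)).isWF
      exact ⟨hwf.min hz, fun _ => ⟨hwf.min_mem hz, fun v hv => hwf.min_le hz hv⟩⟩
    · exact ⟨0, fun h => absurd h hz⟩
  choose V hV using hex
  exact ⟨V, hV⟩

/-- A step between reachable states whose height is at most `ρ`. -/
def LowStep (Step : S → S → Prop) (r : S → S → ℝ) (X : Set S) (V : S → ℝ) (ρ : ℝ) (y z : S) :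
    Prop :=
  y ∈ X ∧ Step y z ∧ V y + r y z ≤ ρ

lemma reflTransGen_lowStep_mono {X : Set S} {V : S → ℝ} {ρ ρ' : ℝ} (h : ρ ≤ ρ') {y z : S}
    (hyz : Relation.ReflTransGen (LowStep Step r X V ρ) y z) :
    Relation.ReflTransGen (LowStep Step r X V ρ') y z :=
  Relation.ReflTransGen.mono (fun _ _ hs => ⟨hs.1, hs.2.1, hs.2.2.trans h⟩) _ _ hyz

lemma CostPath.lowStep {X : Set S} {V : S → ℝ} (hr : ∀ y z, 0 ≤ r y z)
    (hX : ∀ y ∈ X, ∀ z, Step y z → z ∈ X ∧ V z ≤ V y + r y z) {ρ : ℝ} {y z : S} (hy : y ∈ X)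
    {t : ℕ} {c : ℝ} (hp : CostPath Step r y t c z) (hρ : V y + c ≤ ρ) :
    Relation.ReflTransGen (LowStep Step r X V ρ) y z ∧ z ∈ X ∧ V z ≤ V y + c := by
  induction hp with
  | refl => exact ⟨.refl, hy, by simp⟩
  | @snoc t c w z _ hs ih =>
    have := hr w z
    obtain ⟨h1, h2, h3⟩ := ih (by linarith)
    obtain ⟨h4, h5⟩ := hX w h2 z hs
    exact ⟨h1.tail ⟨h2, hs, by linarith⟩, h4, by linarith⟩

lemma pathValues_step {V : S → ℝ} (hV : ∀ z, (pathValues Step r d h z).Nonempty →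
      IsLeast (pathValues Step r d h z) (V z)) (y : S) (hy : (pathValues Step r d h y).Nonempty)
    (z : S) (hs : Step y z) :
    (pathValues Step r d h z).Nonempty ∧ V z ≤ V y + r y z := by
  obtain ⟨a, t, c, hp, hv⟩ := (hV y hy).1
  have hmem : V y + r y z ∈ pathValues Step r d h z :=
    ⟨a, t + 1, c + r y z, hp.snoc hs, by rw [hv]; ring⟩
  exact ⟨⟨_, hmem⟩, (hV z ⟨_, hmem⟩).2 hmem⟩

lemma exists_crossing {R : S → S → Prop} {H : Set S} {x y : S}
    (hp : Relation.ReflTransGen R x y) (hx : x ∈ H) (hy : y ∉ H) :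
    ∃ x' ∈ H, ∃ y' ∉ H, R x' y' := by
  by_contra! hcon
  exact hy (hp.rec hx fun {b c} _ hbc hb => by_contra fun hc => hcon b hb c hc hbc)

end CostPaths

section Concentration

open Matrix

variable {S : Type*} [Fintype S] [DecidableEq S]

/-- Balance of stationary flow across a cut. -/
lemma cut_balance {P : Matrix S S ℝ} (hP : P ∈ rowStochastic ℝ S) {π : S → ℝ} (hπ : π ᵥ* P = π)
    (H : Finset S) :
    ∑ x ∈ H, ∑ y ∈ Hᶜ, π x * P x y = ∑ x ∈ H, ∑ y ∈ Hᶜ, π y * P y x := by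
  have h1 : ∑ x ∈ H, π x = ∑ x ∈ H, ∑ y ∈ H, π x * P x y + ∑ x ∈ H, ∑ y ∈ Hᶜ, π x * P x y := by
    rw [← Finset.sum_add_distrib]
    refine Finset.sum_congr rfl fun x _ => ?_
    rw [Finset.sum_add_sum_compl, ← Finset.mul_sum, sum_row_of_mem_rowStochastic hP, mul_one]
  have h2 : ∑ x ∈ H, π x = ∑ x ∈ H, ∑ y ∈ H, π y * P y x + ∑ x ∈ H, ∑ y ∈ Hᶜ, π y * P y x := by
    rw [← Finset.sum_add_distrib]
    refine Finset.sum_congr rfl fun x _ => ?_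
    rw [Finset.sum_add_sum_compl]
    exact (congrFun hπ x).symm
  rw [Finset.sum_comm (s := H) (t := H) (f := fun x y => π y * P y x)] at h2
  linarith

variable {Step : S → S → Prop} {r : S → S → ℝ} {X : Set S} {V : S → ℝ}
  {P : Matrix S S ℝ} (hP : P ∈ rowStochastic ℝ S) {e c : ℝ} (he : 0 < e) (hc : 0 < c)
  (hlow : ∀ y z, Step y z → c * e ^ r y z ≤ P y z)
  (hup : ∀ y z, Step y z → P y z ≤ e ^ r y z)
  (hzero : ∀ y z, ¬ Step y z → P y z = 0) (he1 : e ≤ 1)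
  (hret : ∀ y ∈ X, ∀ z, Step y z →
    Relation.ReflTransGen (LowStep Step r X V (V y + r y z)) z y)
  (hconn : ∀ y ∈ X, ∀ z ∈ X, ∃ ρ, Relation.ReflTransGen (LowStep Step r X V ρ) y z)
  {π : S → ℝ} (hπ0 : ∀ x, 0 ≤ π x) (hπX : ∀ x ∉ X, π x = 0) (hπ : π ᵥ* P = π)

include hP he hc hlow hup hzero he1 hret hconn hπ0 hπX hπ

/-- A stationary distribution cannot have a large gap, relative to the heights `V`, across a
cut. -/
lemma exists_not_mem_of_cut {H : Finset S} (hHX : ∀ x ∈ H, x ∈ X) {x₀ y₀ : S} (hx₀ : x₀ ∈ H)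
    (hy₀ : y₀ ∉ H) (hy₀X : y₀ ∈ X) {m : ℝ} (hm : 0 < m) (hmH : ∀ x ∈ H, m * e ^ V x ≤ π x) :
    ∃ y ∈ X, y ∉ H ∧ c / (2 * Fintype.card S ^ 2) * m * e ^ V y ≤ π y := by
  by_contra! hcon
  have hcard : (0 : ℝ) < Fintype.card S := by
    have : Nonempty S := ⟨x₀⟩
    exact_mod_cast Fintype.card_pos
  set q : ℝ := c / (2 * Fintype.card S ^ 2) with hq
  set Out := ∑ x ∈ H, ∑ y ∈ Hᶜ, π x * P x y with hOut
  have hPnn : ∀ x y, 0 ≤ P x y := fun x y => nonneg_of_mem_rowStochastic hP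
  have hterm : ∀ x ∈ H, ∀ y ∉ H, π x * P x y ≤ Out := by
    intro x hx y hy
    calc π x * P x y ≤ ∑ y ∈ Hᶜ, π x * P x y := Finset.single_le_sum
          (f := fun y => π x * P x y) (fun y _ => mul_nonneg (hπ0 _) (hPnn _ _))
          (Finset.mem_compl.2 hy)
      _ ≤ Out := Finset.single_le_sum (f := fun x => ∑ y ∈ Hᶜ, π x * P x y)
          (fun x _ => Finset.sum_nonneg fun y _ => mul_nonneg (hπ0 _) (hPnn _ _)) hx
  have hcross : ∀ ρ x y, x ∈ H → y ∉ H →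
      Relation.ReflTransGen (LowStep Step r X V ρ) x y → c * (m * e ^ ρ) ≤ Out := by
    intro ρ x y hx hy hxy
    obtain ⟨x', hx', y', hy', -, hs, hle⟩ := exists_crossing (H := (H : Set S)) hxy hx hy
    calc c * (m * e ^ ρ) ≤ c * (m * e ^ (V x' + r x' y')) := by
          have := Real.rpow_le_rpow_of_exponent_ge he he1 hle
          gcongr
      _ = (m * e ^ V x') * (c * e ^ r x' y') := by rw [Real.rpow_add he]; ring
      _ ≤ π x' * P x' y' := mul_le_mul (hmH _ hx') (hlow _ _ hs) (by positivity) (hπ0 _)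
      _ ≤ Out := hterm _ hx' _ hy'
  have hOut : 0 < Out := by
    obtain ⟨ρ, hρ⟩ := hconn x₀ (hHX _ hx₀) y₀ hy₀X
    exact lt_of_lt_of_le (by positivity) (hcross ρ _ _ hx₀ hy₀ hρ)
  have hin : ∀ x ∈ H, ∀ w ∈ Hᶜ, π w * P w x ≤ Out / (2 * Fintype.card S ^ 2) := by
    intro x hx w hw
    have hw' := Finset.mem_compl.1 hw
    have hnn : 0 ≤ Out / (2 * (Fintype.card S : ℝ) ^ 2) := by positivity
    by_cases hwX : w ∈ X
    swap
    · simpa [hπX w hwX] using hnn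
    by_cases hs : Step w x
    swap
    · simpa [hzero w x hs] using hnn
    calc π w * P w x ≤ (q * m * e ^ V w) * e ^ r w x :=
          mul_le_mul (hcon w hwX hw').le (hup _ _ hs) (hPnn _ _) (by positivity)
      _ = (c * (m * e ^ (V w + r w x))) / (2 * Fintype.card S ^ 2) := by
          rw [Real.rpow_add he, hq]; ring
      _ ≤ _ := by
          gcongr
          exact hcross _ _ _ hx hw' (hret w hwX x hs)
  have hle : Out ≤ Out / 2 := by
    calc Out = ∑ x ∈ H, ∑ y ∈ Hᶜ, π y * P y x := cut_balance hP hπ H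
      _ ≤ ∑ x ∈ H, ∑ y ∈ Hᶜ, Out / (2 * (Fintype.card S : ℝ) ^ 2) :=
          Finset.sum_le_sum fun x hx => Finset.sum_le_sum fun y hy => hin x hx y hy
      _ = (H.card * Hᶜ.card : ℝ) * (Out / (2 * (Fintype.card S : ℝ) ^ 2)) := by
          simp only [Finset.sum_const, nsmul_eq_mul]; ring
      _ ≤ ((Fintype.card S : ℝ) * Fintype.card S) * (Out / (2 * (Fintype.card S : ℝ) ^ 2)) := by
          gcongr
          · exact Finset.card_le_univ _
          · exact Finset.card_le_univ _
      _ = Out / 2 := by field_simp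
  linarith

/-- Along a chain in which every step can be undone at its own height, a stationary distribution
is comparable to `e ^ V`. -/
lemma stationary_comparison {x y : S} (hx : x ∈ X) (hy : y ∈ X) (hc1 : c ≤ 1)
    (hπx : 0 < π x) :
    (c / (2 * Fintype.card S ^ 2)) ^ Fintype.card S * (π x * e ^ (V y - V x)) ≤ π y := by
  have : Nonempty S := ⟨x⟩
  have hcard : (1 : ℝ) ≤ Fintype.card S := by exact_mod_cast Fintype.card_pos
  set q : ℝ := c / (2 * Fintype.card S ^ 2) with hq
  have hq0 : 0 < q := by positivity
  have hq1 : q ≤ 1 := by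
    rw [hq, div_le_one (by positivity)]
    nlinarith
  have hm : 0 < π x * e ^ (-V x) := by positivity
  have key : ∀ j : ℕ, ∃ H : Finset S, x ∈ H ∧ (∀ w ∈ H, w ∈ X) ∧
      (∀ w ∈ H, q ^ j * (π x * e ^ (-V x)) * e ^ V w ≤ π w) ∧ ((∀ w ∈ X, w ∈ H) ∨ j < H.card) := by
    intro j
    induction j with
    | zero =>
      refine ⟨{x}, by simp, by simpa using hx, ?_, by simp⟩
      intro w hw
      rw [Finset.mem_singleton.1 hw, pow_zero, one_mul, mul_assoc, ← Real.rpow_add he]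
      simp
    | succ j ih =>
      obtain ⟨H, h1, h2, h3, h4⟩ := ih
      have hmono : ∀ w ∈ H, q ^ (j + 1) * (π x * e ^ (-V x)) * e ^ V w ≤ π w := by
        intro w hw
        refine le_trans ?_ (h3 w hw)
        have := pow_le_pow_of_le_one hq0.le hq1 (Nat.le_succ j)
        gcongr
      by_cases hall : ∀ w ∈ X, w ∈ H
      · exact ⟨H, h1, h2, hmono, Or.inl hall⟩
      have h4' := h4.resolve_left hall
      push Not at hall
      obtain ⟨y₀, hy₀X, hy₀⟩ := hall
      obtain ⟨w, hwX, hwH, hw⟩ := exists_not_mem_of_cut hP he hc hlow hup hzero he1 hret hconn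
        hπ0 hπX hπ h2 h1 hy₀ hy₀X (by positivity) h3
      refine ⟨insert w H, Finset.mem_insert_of_mem h1, ?_, ?_, Or.inr ?_⟩
      · simpa [hwX] using h2
      · intro v hv
        rcases Finset.mem_insert.1 hv with rfl | hv
        · exact le_trans (le_of_eq (by rw [hq]; ring)) hw
        · exact hmono v hv
      · rw [Finset.card_insert_of_notMem hwH]
        omega
  obtain ⟨H, -, -, h3, h4⟩ := key (Fintype.card S)
  have hyH : y ∈ H := by
    rcases h4 with h4 | h4
    · exact h4 y hy
    · exact absurd (Finset.card_le_univ H) (not_le.2 h4)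
  refine le_trans (le_of_eq ?_) (h3 y hyH)
  rw [sub_eq_neg_add, Real.rpow_add he]
  ring

omit hP he hc hlow hup hzero he1 hret hconn hπ0 hπX hπ in
/-- In the small-noise limit the stationary distribution puts no mass on states that do not
minimize the height. -/
lemma tendsto_stationary_zero {P : ℝ → Matrix S S ℝ} {c : ℝ} (hc : 0 < c) (hc1 : c ≤ 1)
    (hst : ∀ x, 0 < x → x ≤ 1 / 2 → P x ∈ rowStochastic ℝ S)
    (hlow : ∀ x, 0 < x → x ≤ 1 / 2 → ∀ y z, Step y z → c * x ^ r y z ≤ P x y z)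
    (hup : ∀ x, 0 < x → x ≤ 1 / 2 → ∀ y z, Step y z → P x y z ≤ x ^ r y z)
    (hzero : ∀ x, 0 < x → x ≤ 1 / 2 → ∀ y z, ¬ Step y z → P x y z = 0)
    (hX : ∀ y ∈ X, ∀ z, Step y z → z ∈ X)
    (hret : ∀ y ∈ X, ∀ z, Step y z →
      Relation.ReflTransGen (LowStep Step r X V (V y + r y z)) z y)
    (hconn : ∀ y ∈ X, ∀ z ∈ X, ∃ ρ, Relation.ReflTransGen (LowStep Step r X V ρ) y z)
    {b : S} (hb : b ∈ X) {T : ℕ} (hT : 0 < T)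
    (hD : ∀ x, 0 < x → x ≤ 1 / 2 → ∃ δ > 0, ∀ i, δ ≤ matProd (fun _ => P x) 0 T i b)
    {y z : S} (hy : y ∈ X) (hyz : z ∈ X → V y < V z) :
    Tendsto (fun x => stationary (P x) z) (𝓝[>] 0) (𝓝 0) := by
  have hmem : ∀ᶠ x : ℝ in 𝓝[>] 0, 0 < x ∧ x ≤ 1 / 2 :=
    Ioc_mem_nhdsGT (by norm_num : (0 : ℝ) < 1 / 2)
  have hout : ∀ x, 0 < x → x ≤ 1 / 2 → ∀ w ∉ X, stationary (P x) w = 0 := by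
    intro x hx0 hx1 w hw
    obtain ⟨δ, hδ0, hδ⟩ := hD x hx0 hx1
    exact stationary_eq_zero (hst x hx0 hx1) hT hδ0 hδ hb
      (fun i hi j hj => hzero x hx0 hx1 i j fun hs => hj (hX i hi j hs)) hw
  by_cases hz : z ∈ X
  swap
  · refine tendsto_const_nhds.congr' ?_
    filter_upwards [hmem] with x hx
    exact (hout x hx.1 hx.2 z hz).symm
  have hVlt := hyz hz
  have : Nonempty S := ⟨b⟩
  have hcard : (0 : ℝ) < Fintype.card S := by exact_mod_cast Fintype.card_pos
  set Q : ℝ := (c / (2 * Fintype.card S ^ 2)) ^ Fintype.card S with hQ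
  have hQ0 : 0 < Q := by positivity
  have hlim : Tendsto (fun x : ℝ => Q⁻¹ * x ^ (V z - V y)) (𝓝[>] 0) (𝓝 0) := by
    have h := (Real.continuousAt_rpow_const 0 (V z - V y) (Or.inr (by linarith))).tendsto
    rw [Real.zero_rpow (by linarith)] at h
    simpa using (h.mono_left nhdsWithin_le_nhds).const_mul Q⁻¹
  refine tendsto_of_tendsto_of_tendsto_of_le_of_le' tendsto_const_nhds hlim ?_ ?_
  · filter_upwards [hmem] with x ⟨hx0, hx1⟩
    obtain ⟨δ, hδ0, hδ⟩ := hD x hx0 hx1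
    exact stationary_nonneg (hst x hx0 hx1) hT hδ0 hδ z
  · filter_upwards [hmem] with x ⟨hx0, hx1⟩
    obtain ⟨δ, hδ0, hδ⟩ := hD x hx0 hx1
    have hnn := stationary_nonneg (hst x hx0 hx1) hT hδ0 hδ
    rcases (hnn z).eq_or_lt with h0 | hpos
    · rw [← h0]; positivity
    have hcomp := stationary_comparison (hst x hx0 hx1) hx0 hc (hlow x hx0 hx1) (hup x hx0 hx1)
      (hzero x hx0 hx1) (by linarith) hret hconn hnn (hout x hx0 hx1)
      (stationary_vecMul (hst x hx0 hx1) hT hδ0 hδ) hz hy hc1 hpos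
    have hle1 : stationary (P x) y ≤ 1 := by
      rw [← sum_stationary (hst x hx0 hx1) hT hδ0 hδ]
      exact Finset.single_le_sum (fun i _ => hnn i) (Finset.mem_univ y)
    have hpw : x ^ (V y - V z) * x ^ (V z - V y) = 1 := by
      rw [← Real.rpow_add hx0]; simp
    have hp0 : 0 < x ^ (V z - V y) := by positivity
    calc stationary (P x) z
        = Q⁻¹ * ((Q * (stationary (P x) z * x ^ (V y - V z))) * x ^ (V z - V y)) := by
          rw [mul_assoc Q, mul_assoc, hpw, mul_one, inv_mul_cancel_left₀ hQ0.ne']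
      _ ≤ Q⁻¹ * (1 * x ^ (V z - V y)) := by
          gcongr
          exact hcomp.trans hle1
      _ = _ := by rw [one_mul]

end Concentration

section Resistance

open Matrix

variable {ι : Type*} {A : ι → Type*}
  (κ : ℝ) (U : ι → (∀ i, A i) → ℝ) (C : ∀ i, A i → Finset (A i))

/-- The actions that player `i` selects with positive probability from the state `z`. -/
def IsSel (z : (∀ i, A i) × (∀ i, A i)) (i : ι) (x : A i) : Prop :=
  x = z.2 i ∨ x ∈ C i (z.2 i) ∨ (U i z.2 < U i z.1 ∧ x = z.1 i)

/-- The exponent of `ε` in the probability that player `i` selects `x` from the state `z`. -/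
noncomputable def selRes (z : (∀ i, A i) × (∀ i, A i)) (i : ι) (x : A i) : ℝ :=
  if U i z.1 ≤ U i z.2 then (if x = z.2 i then 0 else 1)
  else if x = z.1 i then 0 else if x = z.2 i then U i z.1 - U i z.2 else 1

lemma selRes_nonneg (z : (∀ i, A i) × (∀ i, A i)) (i : ι) (x : A i) : 0 ≤ selRes U z i x := by
  unfold selRes
  split_ifs with h <;> linarith

variable {κ} {C}

lemma selProb_eq_zero {z : (∀ i, A i) × (∀ i, A i)} {i : ι} {x : A i} (ε : ℝ)
    (h : ¬ IsSel U C z i x) : selProb κ U C ε z.1 z.2 i x = 0 := by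
  simp only [IsSel, not_or, not_and] at h
  obtain ⟨h1, h2, h3⟩ := h
  unfold selProb
  split_ifs with h <;> simp_all

lemma selProb_nonneg (hκ : 0 < κ) (hκ2 : κ ≤ 1 / 2) {ε : ℝ} (hε : 0 < ε) (hε1 : ε ≤ 1)
    (z : (∀ i, A i) × (∀ i, A i)) (i : ι) (x : A i) : 0 ≤ selProb κ U C ε z.1 z.2 i x := by
  unfold selProb
  by_cases hU : U i z.1 ≤ U i z.2
  · rw [if_pos hU]
    have : 0 ≤ 1 - ε := by linarith
    split_ifs <;> positivity
  · rw [if_neg hU]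
    set Δ := U i z.1 - U i z.2
    have hΔ : 0 < Δ := by have := not_le.1 hU; simp only [Δ]; linarith
    have hp1 : ε ^ Δ ≤ 1 := Real.rpow_le_one hε.le (by linarith) hΔ.le
    have hp0 : 0 < ε ^ Δ := Real.rpow_pos_of_pos hε _
    have hk : 0 ≤ 1 - κ * ε ^ Δ := by nlinarith
    have : 0 ≤ 1 - ε := by linarith
    split_ifs <;> positivity

variable (κ C) in
lemma isPowerSum_selProb (z : (∀ i, A i) × (∀ i, A i)) (i : ι) (x : A i) :
    IsPowerSum fun ε => selProb κ U C ε z.1 z.2 i x := by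
  have h0 : IsPowerSum fun _ : ℝ => (0 : ℝ) := .const 0
  have h1 : IsPowerSum fun ε : ℝ => 1 - ε := (IsPowerSum.const 1).sub .id
  have h2 : IsPowerSum fun ε : ℝ => κ * ε ^ (U i z.1 - U i z.2) :=
    (IsPowerSum.const κ).mul (.rpow _)
  have h3 : ∀ m : ℕ, IsPowerSum fun ε : ℝ => ε / m := fun m => by
    simpa only [div_eq_mul_inv] using IsPowerSum.id.mul (.const (m : ℝ)⁻¹)
  unfold selProb
  refine .ite _ (.add (.ite _ h1 h0) (.ite _ (h3 _) h0))
    (.add (.add (.ite _ (h1.mul h2) h0) (.ite _ (h1.mul ((IsPowerSum.const 1).sub h2)) h0))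
      (.ite _ (h3 _) h0))

variable [Fintype ι]

variable (κ C) in
/-- The transition matrix of the chain with exploration rate `ε`. -/
noncomputable def phMatrix (ε : ℝ) :
    Matrix ((∀ i, A i) × (∀ i, A i)) ((∀ i, A i) × (∀ i, A i)) ℝ :=
  Matrix.of (phTrans κ U C ε)

variable (C) in
/-- The transitions of the chain that have positive probability. -/
def PhStep (z z' : (∀ i, A i) × (∀ i, A i)) : Prop :=
  z'.1 = z.2 ∧ ∀ i, IsSel U C z i (z'.2 i)

/-- The resistance of a transition. -/
noncomputable def phRes (z z' : (∀ i, A i) × (∀ i, A i)) : ℝ := ∑ i, selRes U z i (z'.2 i)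

lemma phRes_nonneg (z z' : (∀ i, A i) × (∀ i, A i)) : 0 ≤ phRes U z z' :=
  Finset.sum_nonneg fun _ _ => selRes_nonneg U _ _ _

variable (κ C) in
lemma isPowerSum_phMatrix (z z' : (∀ i, A i) × (∀ i, A i)) :
    IsPowerSum fun ε => phMatrix κ U C ε z z' := by
  simp only [phMatrix, Matrix.of_apply, phTrans]
  exact .ite _ (.prod _ fun i _ => isPowerSum_selProb κ U C z i (z'.2 i)) (.const 0)

lemma phMatrix_eq_zero (ε : ℝ) {z z' : (∀ i, A i) × (∀ i, A i)} (h : ¬ PhStep U C z z') :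
    phMatrix κ U C ε z z' = 0 := by
  simp only [phMatrix, Matrix.of_apply, phTrans]
  split_ifs with h1
  · simp only [PhStep, h1, true_and, not_forall] at h
    obtain ⟨i, hi⟩ := h
    exact Finset.prod_eq_zero (Finset.mem_univ i) (selProb_eq_zero U ε hi)
  · rfl

variable [∀ i, Fintype (A i)]

omit [Fintype ι] in
lemma card_erase_bounds {i : ι} (hC : ∀ a : A i, 3 ≤ (C i a).card) (a b : A i) :
    (1 ≤ ((C i a).erase a).card ∧ ((C i a).erase a).card ≤ Fintype.card (A i)) ∧
    (1 ≤ (((C i a).erase a).erase b).card ∧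
      (((C i a).erase a).erase b).card ≤ Fintype.card (A i)) := by
  have h1 := Finset.pred_card_le_card_erase (s := C i a) (a := a)
  have h2 := Finset.pred_card_le_card_erase (s := (C i a).erase a) (a := b)
  have h3 := hC a
  exact ⟨⟨by omega, Finset.card_le_univ _⟩, ⟨by omega, Finset.card_le_univ _⟩⟩

omit [Fintype ι] in
lemma le_selProb (hκ : 0 < κ) (hκ2 : κ ≤ 1 / 2) {i : ι} (hC : ∀ a : A i, 3 ≤ (C i a).card)
    {ε : ℝ} (hε : 0 < ε) (hε2 : ε ≤ 1 / 2) {z : (∀ i, A i) × (∀ i, A i)} {x : A i}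
    (h : IsSel U C z i x) :
    κ / (2 * Fintype.card (A i)) * ε ^ selRes U z i x ≤ selProb κ U C ε z.1 z.2 i x := by
  have hn : (1 : ℝ) ≤ Fintype.card (A i) := by
    have : Nonempty (A i) := ⟨x⟩
    exact_mod_cast Fintype.card_pos
  set n : ℝ := (Fintype.card (A i) : ℝ)
  have hc : κ / (2 * n) ≤ κ / 2 := by gcongr; linarith
  have hc0 : 0 < κ / (2 * n) := by positivity
  obtain ⟨⟨hb1, hb2⟩, ⟨hb3, hb4⟩⟩ := card_erase_bounds hC (z.2 i) (z.1 i)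
  have hexp : ∀ m : ℕ, 1 ≤ m → m ≤ Fintype.card (A i) → κ / (2 * n) * ε ≤ ε / m := by
    intro m hm1 hm2
    have hm1' : (1 : ℝ) ≤ m := by exact_mod_cast hm1
    have hm2' : (m : ℝ) ≤ n := Nat.cast_le.2 hm2
    rw [div_mul_eq_mul_div, div_le_div_iff₀ (by positivity) (by positivity)]
    have : κ * m ≤ 1 * (2 * n) := mul_le_mul (by linarith) (by linarith) (by linarith) (by norm_num)
    nlinarith
  unfold selProb selRes
  by_cases hU : U i z.1 ≤ U i z.2
  · rw [if_pos hU, if_pos hU]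
    by_cases hx : x = z.2 i
    · simp only [hx, if_true, Real.rpow_zero, Finset.mem_erase, ne_eq, not_true_eq_false,
        false_and, if_false]
      linarith
    · have hxC : x ∈ (C i (z.2 i)).erase (z.2 i) := by
        rcases h with h | h | h
        · exact absurd h hx
        · exact Finset.mem_erase.2 ⟨hx, h⟩
        · exact absurd h.1 (not_lt.2 hU)
      rw [if_neg hx, if_neg hx, if_pos hxC, zero_add, Real.rpow_one]
      exact hexp _ hb1 hb2
  · rw [if_neg hU, if_neg hU]
    set Δ := U i z.1 - U i z.2
    have hΔ : 0 < Δ := by have := not_le.1 hU; simp only [Δ]; linarith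
    have hp1 : ε ^ Δ ≤ 1 := Real.rpow_le_one hε.le (by linarith) hΔ.le
    have hp0 : 0 < ε ^ Δ := Real.rpow_pos_of_pos hε _
    have hk : κ * ε ^ Δ ≤ 1 / 2 := by nlinarith
    have ht1 : 0 ≤ (1 - ε) * (κ * ε ^ Δ) := mul_nonneg (by linarith) (by positivity)
    have ht2 : 1 / 4 ≤ (1 - ε) * (1 - κ * ε ^ Δ) := by nlinarith
    have ht3 : κ / 2 * ε ^ Δ ≤ (1 - ε) * (κ * ε ^ Δ) := by
      have : 0 < κ * ε ^ Δ := by positivity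
      nlinarith
    have he : ∀ m : ℕ, 0 ≤ ε / m := fun m => by positivity
    by_cases hx1 : x = z.1 i
    · have : ¬ x ∈ ((C i (z.2 i)).erase (z.2 i)).erase (z.1 i) := by simp [hx1]
      rw [if_pos hx1, if_neg this, if_pos hx1, Real.rpow_zero]
      split_ifs <;> linarith
    · rw [if_neg hx1, if_neg hx1]
      by_cases hx2 : x = z.2 i
      · have : ¬ x ∈ ((C i (z.2 i)).erase (z.2 i)).erase (z.1 i) := by simp [hx2]
        rw [if_pos hx2, if_pos hx2, if_neg this]
        have : κ / (2 * n) * ε ^ Δ ≤ κ / 2 * ε ^ Δ := by gcongr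
        linarith
      · have hxC : x ∈ ((C i (z.2 i)).erase (z.2 i)).erase (z.1 i) := by
          rcases h with h | h | h
          · exact absurd h hx2
          · exact Finset.mem_erase.2 ⟨hx1, Finset.mem_erase.2 ⟨hx2, h⟩⟩
          · exact absurd h.2 hx1
        rw [if_neg hx2, if_neg hx2, if_pos hxC, Real.rpow_one]
        have := hexp _ hb3 hb4
        linarith

omit [Fintype ι] in
lemma selProb_le (hκ : 0 < κ) (hκ2 : κ ≤ 1 / 2) {i : ι} (hC : ∀ a : A i, 3 ≤ (C i a).card)
    {ε : ℝ} (hε : 0 < ε) (hε2 : ε ≤ 1 / 2) (z : (∀ i, A i) × (∀ i, A i)) (x : A i) :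
    selProb κ U C ε z.1 z.2 i x ≤ ε ^ selRes U z i x := by
  obtain ⟨⟨hb1, hb2⟩, ⟨hb3, hb4⟩⟩ := card_erase_bounds hC (z.2 i) (z.1 i)
  have hexp : ∀ m : ℕ, 1 ≤ m → ε / m ≤ ε := by
    intro m hm1
    exact div_le_self hε.le (by exact_mod_cast hm1)
  unfold selProb selRes
  by_cases hU : U i z.1 ≤ U i z.2
  · rw [if_pos hU, if_pos hU]
    by_cases hx : x = z.2 i
    · simp only [hx, if_true, Real.rpow_zero, Finset.mem_erase, ne_eq, not_true_eq_false,
        false_and, if_false]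
      linarith
    · rw [if_neg hx, if_neg hx, zero_add, Real.rpow_one]
      split_ifs
      · exact hexp _ hb1
      · exact hε.le
  · rw [if_neg hU, if_neg hU]
    set Δ := U i z.1 - U i z.2
    have hΔ : 0 < Δ := by have := not_le.1 hU; simp only [Δ]; linarith
    have hp1 : ε ^ Δ ≤ 1 := Real.rpow_le_one hε.le (by linarith) hΔ.le
    have hp0 : 0 < ε ^ Δ := Real.rpow_pos_of_pos hε _
    have hk : κ * ε ^ Δ ≤ 1 / 2 := by nlinarith
    have hk0 : 0 < κ * ε ^ Δ := by positivity
    by_cases hx1 : x = z.1 i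
    · have : ¬ x ∈ ((C i (z.2 i)).erase (z.2 i)).erase (z.1 i) := by simp [hx1]
      rw [if_pos hx1, if_neg this, if_pos hx1, Real.rpow_zero]
      split_ifs <;> nlinarith
    · rw [if_neg hx1, if_neg hx1]
      by_cases hx2 : x = z.2 i
      · have : ¬ x ∈ ((C i (z.2 i)).erase (z.2 i)).erase (z.1 i) := by simp [hx2]
        rw [if_pos hx2, if_pos hx2, if_neg this]
        nlinarith
      · rw [if_neg hx2, if_neg hx2, zero_add, zero_add, Real.rpow_one]
        split_ifs
        · exact hexp _ hb3
        · exact hε.le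

omit [Fintype ι] in
lemma sum_selProb {i : ι} (hC : ∀ a : A i, 3 ≤ (C i a).card) (ε : ℝ)
    (z : (∀ i, A i) × (∀ i, A i)) : ∑ x, selProb κ U C ε z.1 z.2 i x = 1 := by
  obtain ⟨⟨hb1, hb2⟩, ⟨hb3, hb4⟩⟩ := card_erase_bounds hC (z.2 i) (z.1 i)
  have hunif : ∀ s : Finset (A i), 1 ≤ s.card →
      ∑ x, (if x ∈ s then ε / s.card else 0) = ε := by
    intro s hs
    have : (s.card : ℝ) ≠ 0 := by positivity
    rw [← Finset.sum_filter, Finset.filter_mem_eq_inter, Finset.univ_inter, Finset.sum_const,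
      nsmul_eq_mul, mul_div_cancel₀ _ this]
  unfold selProb
  by_cases hU : U i z.1 ≤ U i z.2
  · simp only [if_pos hU, Finset.sum_add_distrib, Finset.sum_ite_eq', Finset.mem_univ, if_true,
      hunif _ hb1]
    ring
  · simp only [if_neg hU, Finset.sum_add_distrib, Finset.sum_ite_eq', Finset.mem_univ, if_true,
      hunif _ hb3]
    ring

lemma sum_phTrans [DecidableEq ι] (hC : ∀ i, ∀ a : A i, 3 ≤ (C i a).card) (ε : ℝ)
    (z : (∀ i, A i) × (∀ i, A i)) : ∑ z', phTrans κ U C ε z z' = 1 := by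
  simp only [phTrans, Fintype.sum_prod_type]
  rw [Finset.sum_comm]
  simp only [Finset.sum_ite_eq', Finset.mem_univ, if_true]
  rw [← Fintype.prod_sum]
  exact Finset.prod_eq_one fun i _ => sum_selProb U (hC i) ε z

lemma sum_transProd [DecidableEq ι] (hC : ∀ i, ∀ a : A i, 3 ≤ (C i a).card) (εs : ℕ → ℝ)
    (k m : ℕ) (z : (∀ i, A i) × (∀ i, A i)) : ∑ z', transProd κ U C εs k m z z' = 1 := by
  induction m with
  | zero => simp [transProd]
  | succ m ih =>
    simp only [transProd]
    rw [Finset.sum_comm]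
    simp only [← Finset.mul_sum, sum_phTrans U hC, mul_one, ih]

lemma phMatrix_mem_rowStochastic [DecidableEq ι] (hκ : 0 < κ) (hκ2 : κ ≤ 1 / 2)
    (hC : ∀ i, ∀ a : A i, 3 ≤ (C i a).card) {ε : ℝ} (hε : 0 < ε) (hε1 : ε ≤ 1) :
    phMatrix κ U C ε ∈ rowStochastic ℝ ((∀ i, A i) × (∀ i, A i)) := by
  refine mem_rowStochastic_iff_sum.2 ⟨fun z z' => ?_, fun z => ?_⟩
  · simp only [phMatrix, Matrix.of_apply, phTrans]
    split_ifs
    · exact Finset.prod_nonneg fun i _ => selProb_nonneg U hκ hκ2 hε hε1 z i _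
    · exact le_rfl
  · exact sum_phTrans U hC ε z

lemma le_phMatrix (hκ : 0 < κ) (hκ2 : κ ≤ 1 / 2) (hC : ∀ i, ∀ a : A i, 3 ≤ (C i a).card)
    {ε : ℝ} (hε : 0 < ε) (hε2 : ε ≤ 1 / 2) {z z' : (∀ i, A i) × (∀ i, A i)}
    (h : PhStep U C z z') :
    (∏ i, κ / (2 * Fintype.card (A i))) * ε ^ phRes U z z' ≤ phMatrix κ U C ε z z' := by
  simp only [phMatrix, Matrix.of_apply, phTrans, if_pos h.1, phRes]
  rw [Real.rpow_sum_of_pos hε, ← Finset.prod_mul_distrib]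
  exact Finset.prod_le_prod (fun i _ => by positivity)
    fun i _ => le_selProb U hκ hκ2 (hC i) hε hε2 (h.2 i)

lemma phMatrix_le (hκ : 0 < κ) (hκ2 : κ ≤ 1 / 2) (hC : ∀ i, ∀ a : A i, 3 ≤ (C i a).card)
    {ε : ℝ} (hε : 0 < ε) (hε2 : ε ≤ 1 / 2) {z z' : (∀ i, A i) × (∀ i, A i)}
    (h : PhStep U C z z') : phMatrix κ U C ε z z' ≤ ε ^ phRes U z z' := by
  simp only [phMatrix, Matrix.of_apply, phTrans, if_pos h.1, phRes]
  rw [Real.rpow_sum_of_pos hε]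
  exact Finset.prod_le_prod (fun i _ => selProb_nonneg U hκ hκ2 hε (by linarith) z i _)
    fun i _ => selProb_le U hκ hκ2 (hC i) hε hε2 z _

variable (κ C) in
lemma transProd_eq_matProd [DecidableEq ι] (εs : ℕ → ℝ) (k m : ℕ) (z z' : (∀ i, A i) × (∀ i, A i)) :
    transProd κ U C εs k m z z' = matProd (fun j => phMatrix κ U C (εs j)) k m z z' := by
  induction m generalizing z' with
  | zero => simp [transProd, matProd, Matrix.one_apply]
  | succ m ih => simp only [transProd, matProd, Matrix.mul_apply, ih]; rfl

end Resistance

section GamePaths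

variable {ι : Type*} [Fintype ι] {A : ι → Type*}
  {U : ι → (∀ i, A i) → ℝ} {C : ∀ i, A i → Finset (A i)} {φ : (∀ i, A i) → ℝ}

/-- The transition in which every player keeps the better of its last two actions. -/
noncomputable def greedyStep (U : ι → (∀ i, A i) → ℝ) (z : (∀ i, A i) × (∀ i, A i)) :
    (∀ i, A i) × (∀ i, A i) :=
  (z.2, fun i => if U i z.1 ≤ U i z.2 then z.2 i else z.1 i)

variable (C) in
omit [Fintype ι] in
lemma phStep_greedyStep (z : (∀ i, A i) × (∀ i, A i)) : PhStep U C z (greedyStep U z) := by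
  refine ⟨rfl, fun i => ?_⟩
  simp only [greedyStep, IsSel]
  split_ifs with h
  · exact Or.inl rfl
  · exact Or.inr (Or.inr ⟨not_le.1 h, rfl⟩)

lemma phRes_greedyStep (z : (∀ i, A i) × (∀ i, A i)) : phRes U z (greedyStep U z) = 0 := by
  refine Finset.sum_eq_zero fun i _ => ?_
  simp only [greedyStep, selRes]
  split_ifs <;> simp_all

variable (U C) in
lemma costPath_greedyStep (z : (∀ i, A i) × (∀ i, A i)) :
    CostPath (PhStep U C) (phRes U) z 1 0 (greedyStep U z) := by
  simpa only [phRes_greedyStep] using CostPath.single (r := phRes U) (phStep_greedyStep (U := U) C z)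

omit [Fintype ι] in
lemma greedyStep_diag (a : ∀ i, A i) : greedyStep U (a, a) = (a, a) := by
  simp [greedyStep]

variable (U C) in
lemma costPath_diag (a : ∀ i, A i) (t : ℕ) :
    CostPath (PhStep U C) (phRes U) (a, a) t 0 (a, a) := by
  induction t with
  | zero => exact .refl
  | succ t ih => simpa [greedyStep_diag] using ih.trans (costPath_greedyStep U C (a, a))

variable (U C) in
lemma exists_costPath_diag (z : (∀ i, A i) × (∀ i, A i)) :
    ∃ t b, CostPath (PhStep U C) (phRes U) z t 0 (b, b) := by
  induction hM : (Finset.univ.filter fun i => z.1 i ≠ z.2 i).card using Nat.strong_induction_on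
    generalizing z with
  | _ M ih =>
    have hstep := costPath_greedyStep U C z
    by_cases hlt : (Finset.univ.filter fun i =>
        (greedyStep U z).1 i ≠ (greedyStep U z).2 i).card < M
    · obtain ⟨t, b, h⟩ := ih _ hlt (greedyStep U z) rfl
      exact ⟨1 + t, b, by simpa using hstep.trans h⟩
    · have hsub : (Finset.univ.filter fun i => (greedyStep U z).1 i ≠ (greedyStep U z).2 i) ⊆
          Finset.univ.filter fun i => z.1 i ≠ z.2 i := by
        intro i hi
        refine Finset.mem_filter.2 ⟨Finset.mem_univ _, fun h0 => (Finset.mem_filter.1 hi).2 ?_⟩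
        simp [greedyStep, h0]
      have heq := Finset.eq_of_subset_of_card_le hsub (by omega)
      have hdec : ∀ i, z.1 i ≠ z.2 i → U i z.2 < U i z.1 := by
        intro i hi
        have : i ∈ Finset.univ.filter fun i => (greedyStep U z).1 i ≠ (greedyStep U z).2 i := by
          rw [heq]; simpa using hi
        by_contra hU
        exact (Finset.mem_filter.1 this).2 (by simp [greedyStep, not_lt.1 hU])
      have hz : greedyStep U (greedyStep U z) = (z.1, z.1) := by
        have h1 : greedyStep U z = (z.2, z.1) := by
          refine Prod.ext rfl (funext fun i => ?_)
          by_cases hi : z.1 i = z.2 i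
          · simp [greedyStep, hi]
          · simp [greedyStep, not_le.2 (hdec i hi)]
        rw [h1]
        refine Prod.ext rfl (funext fun i => ?_)
        by_cases hi : z.1 i = z.2 i
        · simp [greedyStep, hi]
        · simp [greedyStep, (hdec i hi).le]
      exact ⟨1 + 1, z.1, by simpa [hz] using hstep.trans (costPath_greedyStep U C _)⟩

variable [DecidableEq ι]

lemma exists_costPath_diag_uniform [∀ i, Fintype (A i)] :
    ∃ T, ∀ z : (∀ i, A i) × (∀ i, A i), ∃ b, CostPath (PhStep U C) (phRes U) z T 0 (b, b) := by
  choose t b h using exists_costPath_diag U C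
  refine ⟨Finset.univ.sup t, fun z => ⟨b z, ?_⟩⟩
  have hle : t z ≤ Finset.univ.sup t := Finset.le_sup (Finset.mem_univ z)
  have := (h z).trans (costPath_diag U C (b z) (Finset.univ.sup t - t z))
  rwa [Nat.add_sub_of_le hle, add_zero] at this

omit [Fintype ι] [DecidableEq ι] in
lemma selRes_of_eq {z : (∀ i, A i) × (∀ i, A i)} {i : ι} (h : z.1 i = z.2 i) :
    selRes U z i (z.2 i) = 0 := by
  simp [selRes, h]

omit [Fintype ι] in
lemma selRes_update (hpot : IsPotentialGame U C φ) (p : ∀ i, A i) {i : ι} {y : A i}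
    (hy : y ∈ C i (p i)) :
    selRes U (p, Function.update p i y) i y = max 0 (φ p - φ (Function.update p i y)) := by
  have h := hpot i p y hy
  simp only [selRes, Function.update_self, if_true]
  split_ifs with h1 h2
  · rw [max_eq_left (by linarith)]
  · exact absurd (by rw [h2, Function.update_eq_self]) h1
  · rw [max_eq_right (by linarith)]; linarith

omit [Fintype ι] in
lemma selRes_le_one (hA1 : Assumption1 C) (hA3 : Assumption3 U C) (p : ∀ i, A i) {i : ι}
    {y : A i} (hy : y ∈ C i (p i) ∨ y = p i) (x : A i) :
    selRes U (p, Function.update p i y) i x ≤ 1 := by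
  rcases hy with hy | rfl
  · have h := hA3 i (Function.update p i y) (p i)
      (by rw [Function.update_self]; exact (hA1.1 _ _ _).1 hy)
    rw [Function.update_idem, Function.update_eq_self] at h
    simp only [selRes]
    split_ifs <;> linarith
  · simp only [selRes, Function.update_eq_self, le_refl, if_true]
    split_ifs <;> norm_num

omit [Fintype ι] in
lemma phStep_update (p : ∀ i, A i) {i : ι} {x y : A i} (hx : x ∈ C i y ∨ x = y) :
    PhStep U C (p, Function.update p i y) (Function.update p i y, Function.update p i x) := by
  refine ⟨rfl, fun j => ?_⟩
  by_cases hj : j = i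
  · subst hj
    simp only [IsSel, Function.update_self]
    tauto
  · exact Or.inl (by simp [hj])

lemma phRes_update (p : ∀ i, A i) {i : ι} {x y : A i} :
    phRes U (p, Function.update p i y) (Function.update p i y, Function.update p i x) =
      selRes U (p, Function.update p i y) i x := by
  rw [phRes, Finset.sum_eq_single i]
  · simp
  · intro j _ hj
    have := selRes_of_eq (U := U) (z := (p, Function.update p i y)) (i := j) (by simp [hj])
    simpa [hj] using this
  · simp

lemma exists_costPath_reachIn (hA1 : Assumption1 C) (hA3 : Assumption3 U C) (w : ∀ i, A i)
    {i : ι} {d : ℕ} {y : A i} (h : ReachIn C i d (w i) y) :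
    ∃ p, (y ∈ C i p ∨ y = p) ∧ ∃ c ≤ (d : ℝ), CostPath (PhStep U C) (phRes U) (w, w) d c
      (Function.update w i p, Function.update w i y) := by
  have hstep : ∀ p v x : A i, (v ∈ C i p ∨ v = p) → (x ∈ C i v ∨ x = v) → ∃ c ≤ (1 : ℝ),
      CostPath (PhStep U C) (phRes U) (Function.update w i p, Function.update w i v) 1 c
        (Function.update w i v, Function.update w i x) := by
    intro p v x hv hx
    have h1 := phStep_update (U := U) (Function.update w i p) hx
    have h2 := phRes_update (U := U) (Function.update w i p) (x := x) (y := v)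
    have h3 := selRes_le_one hA1 hA3 (Function.update w i p) (y := v)
      (by rwa [Function.update_self]) x
    rw [← h2] at h3
    simp only [Function.update_idem] at h1 h3
    exact ⟨_, h3, .single h1⟩
  induction d generalizing y with
  | zero =>
    obtain rfl : w i = y := h
    exact ⟨w i, Or.inr rfl, 0, by simp, by simpa using CostPath.refl⟩
  | succ d ih =>
    rcases h with h | ⟨v, h, hy⟩
    · obtain ⟨p, hp, c, hc, hpath⟩ := ih h
      obtain ⟨c', hc', hpath'⟩ := hstep p y y hp (Or.inr rfl)
      exact ⟨y, Or.inr rfl, c + c', by push_cast; linarith, hpath.trans hpath'⟩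
    · obtain ⟨p, hp, c, hc, hpath⟩ := ih h
      obtain ⟨c', hc', hpath'⟩ := hstep p v y hp (Or.inl hy)
      exact ⟨v, Or.inl hy, c + c', by push_cast; linarith, hpath.trans hpath'⟩

lemma exists_costPath_update (hA1 : Assumption1 C) (hA3 : Assumption3 U C) (w : ∀ i, A i)
    {i : ι} {d : ℕ} {y : A i} (h : ReachIn C i d (w i) y) :
    ∃ c ≤ (d + 1 : ℝ), CostPath (PhStep U C) (phRes U) (w, w) (d + 1) c
      (Function.update w i y, Function.update w i y) := by
  obtain ⟨p, hp, c, hc, hpath⟩ := exists_costPath_reachIn hA1 hA3 w h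
  have h1 := phStep_update (U := U) (C := C) (Function.update w i p) (Or.inr (Eq.refl y))
  have h2 := phRes_update (U := U) (Function.update w i p) (x := y) (y := y)
  have h3 := selRes_le_one hA1 hA3 (Function.update w i p) (y := y)
    (by rwa [Function.update_self]) y
  rw [← h2] at h3
  simp only [Function.update_idem] at h1 h3
  exact ⟨_, add_le_add hc h3, hpath.snoc h1⟩

lemma exists_costPath_piecewise (hA1 : Assumption1 C) (hA3 : Assumption3 U C) {D : ℕ}
    (hD : ∀ (i : ι) (x y : A i), ReachIn C i D x y) (w b : ∀ i, A i) (s : Finset ι) :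
    ∃ c ≤ (s.card * (D + 1) : ℝ), CostPath (PhStep U C) (phRes U) (w, w) (s.card * (D + 1)) c
      (s.piecewise b w, s.piecewise b w) := by
  induction s using Finset.induction_on with
  | empty => exact ⟨0, by simp, by simpa using CostPath.refl⟩
  | insert i s hi ih =>
    obtain ⟨c, hc, hpath⟩ := ih
    obtain ⟨c', hc', hpath'⟩ := exists_costPath_update hA1 hA3 (s.piecewise b w)
      (hD i (s.piecewise b w i) (b i))
    rw [Finset.piecewise_insert, Finset.card_insert_of_notMem hi, add_mul, one_mul]
    exact ⟨c + c', by push_cast; linarith, hpath.trans hpath'⟩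

/-- From every state a given diagonal state is reached in a fixed number of steps at cost at most
`n (D + 1)`. -/
lemma exists_costPath_target [∀ i, Fintype (A i)] (hA1 : Assumption1 C) (hA3 : Assumption3 U C)
    {D : ℕ} (hD : ∀ (i : ι) (x y : A i), ReachIn C i D x y) (b : ∀ i, A i) :
    ∃ T > 0, ∀ z, ∃ c ≤ (Fintype.card ι * (D + 1) : ℝ),
      CostPath (PhStep U C) (phRes U) z T c (b, b) := by
  obtain ⟨T, hT⟩ := exists_costPath_diag_uniform (U := U) (C := C)
  refine ⟨T + Fintype.card ι * (D + 1) + 1, by omega, fun z => ?_⟩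
  obtain ⟨w, hw⟩ := hT z
  obtain ⟨c, hc, hpath⟩ := exists_costPath_piecewise hA1 hA3 hD w b Finset.univ
  rw [Finset.piecewise_univ] at hpath
  exact ⟨0 + c + 0, by simpa using hc, (hw.trans hpath).trans (costPath_diag U C b 1)⟩

end GamePaths

section Returns

variable {ι : Type*} {A : ι → Type*}
  {U : ι → (∀ i, A i) → ℝ} {C : ∀ i, A i → Finset (A i)} {φ : (∀ i, A i) → ℝ}

/-- `UniWalk C a m b`: there is a walk of `m` unilateral feasible deviations from `a` to `b`. -/
inductive UniWalk [DecidableEq ι] (C : ∀ i, A i → Finset (A i)) (a : ∀ i, A i) :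
    ℕ → (∀ i, A i) → Prop
  | refl : UniWalk C a 0 a
  | snoc {m : ℕ} {b : ∀ i, A i} {i : ι} {y : A i} : UniWalk C a m b → y ∈ C i (b i) →
      UniWalk C a (m + 1) (Function.update b i y)

variable [DecidableEq ι]

lemma abs_potential_update_sub_le (hA1 : Assumption1 C) (hA3 : Assumption3 U C)
    (hpot : IsPotentialGame U C φ) (b : ∀ i, A i) {i : ι} {y : A i} (hy : y ∈ C i (b i)) :
    |φ (Function.update b i y) - φ b| ≤ 1 / 2 := by
  have h1 := hA3 i b y hy
  have h2 := hA3 i (Function.update b i y) (b i)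
    (by rw [Function.update_self]; exact (hA1.1 _ _ _).1 hy)
  rw [Function.update_idem, Function.update_eq_self] at h2
  rw [← hpot i b y hy, abs_le]
  constructor <;> linarith

lemma UniWalk.abs_potential_sub_le (hA1 : Assumption1 C) (hA3 : Assumption3 U C)
    (hpot : IsPotentialGame U C φ) {a b : ∀ i, A i} {m : ℕ} (h : UniWalk C a m b) :
    |φ b - φ a| ≤ m / 2 := by
  induction h with
  | refl => simp
  | @snoc m b i y _ hy ih =>
    have := abs_potential_update_sub_le hA1 hA3 hpot b hy
    rw [abs_le] at *
    push_cast
    constructor <;> linarith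

lemma UniWalk.exists_update {a b : ∀ i, A i} {m d : ℕ} {i : ι} {y : A i} (h : UniWalk C a m b)
    (hy : ReachIn C i d (b i) y) :
    ∃ m' ≤ m + d, UniWalk C a m' (Function.update b i y) := by
  induction d generalizing y with
  | zero =>
    obtain rfl : b i = y := hy
    exact ⟨m, le_rfl, by simpa using h⟩
  | succ d ih =>
    rcases hy with hy | ⟨v, hv, hy⟩
    · obtain ⟨m', hm', h'⟩ := ih hy
      exact ⟨m', by omega, h'⟩
    · obtain ⟨m', hm', h'⟩ := ih hv
      have h1 := h'.snoc (i := i) (y := y) (by simpa using hy)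
      rw [Function.update_idem] at h1
      exact ⟨m' + 1, by omega, h1⟩

lemma exists_uniWalk [Fintype ι] {a b : ∀ i, A i} {e : ι → ℕ}
    (h : ∀ i, ReachIn C i (e i) (a i) (b i)) : ∃ m ≤ ∑ i, e i, UniWalk C a m b := by
  have key : ∀ s : Finset ι, ∃ m ≤ ∑ i ∈ s, e i, UniWalk C a m (s.piecewise b a) := by
    intro s
    induction s using Finset.induction_on with
    | empty => exact ⟨0, by simp, by simpa using UniWalk.refl⟩
    | insert i s hi ih =>
      obtain ⟨m, hm, hw⟩ := ih
      have hi' := h i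
      rw [← Finset.piecewise_eq_of_notMem s b a hi] at hi'
      obtain ⟨m', hm', hw'⟩ := hw.exists_update hi'
      rw [Finset.piecewise_insert, Finset.sum_insert hi]
      exact ⟨m', by omega, hw'⟩
  simpa using key Finset.univ

variable [Fintype ι]

/-- The set of states that can be reached from a diagonal state. -/
def diagReachable (U : ι → (∀ i, A i) → ℝ) (C : ∀ i, A i → Finset (A i)) (φ : (∀ i, A i) → ℝ) :
    Set ((∀ i, A i) × (∀ i, A i)) :=
  {z | (pathValues (PhStep U C) (phRes U) (fun a => (a, a)) (fun a => -φ a) z).Nonempty}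

omit [DecidableEq ι] in
lemma zero_pathValue (a : ∀ i, A i) :
    -φ a ∈ pathValues (PhStep U C) (phRes U) (fun a => (a, a)) (fun a => -φ a) (a, a) :=
  ⟨a, 0, 0, .refl, by simp⟩

omit [DecidableEq ι] in
lemma diag_mem_diagReachable (a : ∀ i, A i) : (a, a) ∈ diagReachable U C φ :=
  ⟨_, zero_pathValue a⟩

lemma exists_costPath_edge (hA1 : Assumption1 C) (hA3 : Assumption3 U C)
    (hpot : IsPotentialGame U C φ) (b : ∀ i, A i) {i : ι} {y : A i} (hy : y ∈ C i (b i)) :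
    ∃ c ≤ 1 + max 0 (φ b - φ (Function.update b i y)),
      CostPath (PhStep U C) (phRes U) (b, b) 2 c
        (Function.update b i y, Function.update b i y) := by
  have h1 := phStep_update (U := U) (C := C) b (i := i) (y := b i) (Or.inl hy)
  have h2 := phRes_update (U := U) b (i := i) (y := b i) (x := y)
  have h3 := selRes_le_one hA1 hA3 b (i := i) (y := b i) (Or.inr rfl) y
  rw [← h2] at h3
  simp only [Function.update_eq_self] at h1 h3
  have h4 := phStep_update (U := U) (C := C) b (i := i) (Or.inr (Eq.refl y))
  have h5 := phRes_update (U := U) b (i := i) (y := y) (x := y)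
  rw [selRes_update hpot b hy] at h5
  exact ⟨_, add_le_add h3 h5.le, (CostPath.single h1).snoc h4⟩

omit [DecidableEq ι] [Fintype ι] in
lemma IsSel.exists_exploration {z : (∀ i, A i) × (∀ i, A i)} {i : ι} {x : A i}
    (h : IsSel U C z i x) : ∃ δ : ℕ, (δ : ℝ) ≤ selRes U z i x ∧
      ((δ = 0 ∧ (x = z.2 i ∨ x = z.1 i)) ∨ (δ = 1 ∧ x ∈ C i (z.2 i))) := by
  by_cases hx : x = z.2 i ∨ x = z.1 i
  · exact ⟨0, by simpa using selRes_nonneg U z i x, Or.inl ⟨rfl, hx⟩⟩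
  · obtain ⟨h1, h2⟩ := not_or.1 hx
    refine ⟨1, ?_, Or.inr ⟨rfl, ?_⟩⟩
    · simp [selRes, h1, h2]
    · rcases h with h | h | h
      · exact absurd h h1
      · exact h
      · exact absurd h.2 h2

/-- The shape of a path with cost `c` and at most one exploration from the diagonal state of `a`
to the state `z`. -/
def NearDiag (C : ∀ i, A i → Finset (A i)) (φ : (∀ i, A i) → ℝ) (a : ∀ i, A i) (k : ℕ) (c : ℝ)
    (z : (∀ i, A i) × (∀ i, A i)) : Prop :=
  z = (a, a) ∨ 1 ≤ k ∧ ∃ i, ∃ y ∈ C i (a i), z = (a, Function.update a i y) ∨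
    z = (Function.update a i y, a) ∨ (z = (Function.update a i y, Function.update a i y) ∧
      1 + max 0 (φ a - φ (Function.update a i y)) ≤ c)

lemma NearDiag.step (hpot : IsPotentialGame U C φ) {a : ∀ i, A i} {k l : ℕ} {c : ℝ}
    {z z' : (∀ i, A i) × (∀ i, A i)} (h : NearDiag C φ a k c z) (hkc : (k : ℝ) ≤ c)
    (hs : PhStep U C z z') {δ : ι → ℕ} (hl : l = k + ∑ i, δ i)
    (hδ : ∀ i, (δ i = 0 ∧ (z'.2 i = z.2 i ∨ z'.2 i = z.1 i)) ∨
      (δ i = 1 ∧ z'.2 i ∈ C i (z.2 i))) :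
    2 ≤ l ∨ NearDiag C φ a l (c + phRes U z z') z' := by
  by_cases hl2 : 2 ≤ l
  · exact Or.inl hl2
  right
  obtain ⟨p, q⟩ := z
  obtain ⟨q', w⟩ := z'
  obtain rfl : q = q' := hs.1.symm
  have hr := phRes_nonneg U (p, q) (q, w)
  by_cases h0 : ∑ i, δ i = 0
  · have hw : ∀ i, w i = q i ∨ w i = p i := by
      intro i
      rcases hδ i with hi | hi
      · exact hi.2
      · have := (Finset.sum_eq_zero_iff.1 h0) i (Finset.mem_univ i)
        omega
    obtain rfl : l = k := by omega
    rcases h with h | ⟨hk, i, y, hy, h | h | ⟨h, hc⟩⟩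
    · obtain ⟨rfl, rfl⟩ := Prod.mk.inj h.symm
      exact Or.inl (Prod.ext rfl (funext fun i => by simpa using hw i))
    · obtain ⟨rfl, rfl⟩ := Prod.mk.inj h.symm
      refine Or.inr ⟨hk, i, y, hy, ?_⟩
      have hne : ∀ j, j ≠ i → w j = a j := fun j hj => by simpa [hj] using hw j
      rcases hw i with hi | hi
      · have hwq : w = Function.update a i y := by
          funext j
          by_cases hj : j = i
          · subst hj; exact hi
          · rw [hne j hj, Function.update_of_ne hj]
        refine Or.inr (Or.inr ⟨by rw [hwq], ?_⟩)
        rw [hwq, phRes_update, selRes_update hpot a hy]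
        have : (1 : ℝ) ≤ l := by exact_mod_cast hk
        linarith
      · have hwa : w = a := by
          funext j
          by_cases hj : j = i
          · subst hj; exact hi
          · exact hne j hj
        exact Or.inr (Or.inl (by rw [hwa]))
    · obtain ⟨rfl, rfl⟩ := Prod.mk.inj h.symm
      have hne : ∀ j, j ≠ i → w j = a j := fun j hj => by simpa [hj] using hw j
      rcases hw i with hi | hi
      · refine Or.inl (Prod.ext rfl (funext fun j => ?_))
        by_cases hj : j = i
        · subst hj; exact hi
        · exact hne j hj
      · refine Or.inr ⟨hk, i, y, hy, Or.inl (Prod.ext rfl (funext fun j => ?_))⟩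
        by_cases hj : j = i
        · subst hj; exact hi
        · exact (hne j hj).trans (Function.update_of_ne hj _ _).symm
    · obtain ⟨rfl, rfl⟩ := Prod.mk.inj h.symm
      exact Or.inr ⟨hk, i, y, hy, Or.inr (Or.inr
        ⟨Prod.ext rfl (funext fun j => by simpa using hw j), by linarith⟩)⟩
  · have hk : k = 0 := by omega
    rcases h with h | ⟨hk', -⟩
    swap
    · omega
    obtain ⟨rfl, rfl⟩ := Prod.mk.inj h.symm
    obtain ⟨i, -, hi⟩ := Finset.exists_ne_zero_of_sum_ne_zero h0
    have hsum := Finset.add_sum_erase Finset.univ δ (Finset.mem_univ i)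
    have hrest : ∑ j ∈ Finset.univ.erase i, δ j = 0 := by omega
    have hne : ∀ j, j ≠ i → w j = a j := by
      intro j hj
      have := (Finset.sum_eq_zero_iff.1 hrest) j (by simp [hj])
      rcases hδ j with h | h
      · simpa using h.2
      · omega
    have hwi : w i ∈ C i (a i) := by
      rcases hδ i with h | h
      · exact absurd h.1 hi
      · exact h.2
    refine Or.inr ⟨by omega, i, w i, hwi, Or.inl (Prod.ext rfl (funext fun j => ?_))⟩
    by_cases hj : j = i
    · subst hj; simp
    · exact (hne j hj).trans (Function.update_of_ne hj _ _).symm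

/-- A path of cost `c` from the diagonal state of `a` allows for at most `c` explorations. -/
lemma CostPath.exists_explorations (hpot : IsPotentialGame U C φ) {a : ∀ i, A i} {t : ℕ} {c : ℝ}
    {z : (∀ i, A i) × (∀ i, A i)} (h : CostPath (PhStep U C) (phRes U) (a, a) t c z) :
    ∃ e : ι → ℕ, (∑ i, e i : ℕ) ≤ c ∧ (∀ i, ReachIn C i (e i) (a i) (z.1 i)) ∧
      (∀ i, ReachIn C i (e i) (a i) (z.2 i)) ∧
      (2 ≤ ∑ i, e i ∨ NearDiag C φ a (∑ i, e i) c z) := by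
  induction h with
  | refl => exact ⟨0, by simp, fun i => rfl, fun i => rfl, Or.inr (Or.inl rfl)⟩
  | @snoc t c z z' _ hs ih =>
    obtain ⟨e, he, h1, h2, h3⟩ := ih
    choose δ hδ1 hδ2 using fun i => (hs.2 i).exists_exploration
    have hsum : ∑ i, (e i + δ i) = ∑ i, e i + ∑ i, δ i := Finset.sum_add_distrib
    refine ⟨fun i => e i + δ i, ?_, fun i => ?_, fun i => ?_, ?_⟩
    · rw [hsum, Nat.cast_add]
      refine add_le_add he ?_
      rw [Nat.cast_sum]
      exact Finset.sum_le_sum fun i _ => hδ1 i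
    · rw [congrFun hs.1 i]
      rcases hδ2 i with ⟨h, -⟩ | ⟨h, -⟩
      · simp only [h]; exact h2 i
      · simp only [h]; exact Or.inl (h2 i)
    · rcases hδ2 i with ⟨h, h' | h'⟩ | ⟨h, h'⟩
      · simp only [h, h']; exact h2 i
      · simp only [h, h']; exact h1 i
      · simp only [h]; exact Or.inr ⟨_, h2 i, h'⟩
    · rcases h3 with h3 | h3
      · exact Or.inl (by rw [hsum]; omega)
      · exact h3.step hpot he hs hsum hδ2

variable {V : (∀ i, A i) × (∀ i, A i) → ℝ}
  (hV : ∀ z, (pathValues (PhStep U C) (phRes U) (fun a => (a, a)) (fun a => -φ a) z).Nonempty →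
    IsLeast (pathValues (PhStep U C) (phRes U) (fun a => (a, a)) (fun a => -φ a) z) (V z))

include hV

omit [DecidableEq ι] in
lemma height_diag_le (a : ∀ i, A i) : V (a, a) ≤ -φ a :=
  (hV _ (diag_mem_diagReachable a)).2 (zero_pathValue a)

omit [DecidableEq ι] in
lemma diagReachable_step (y : (∀ i, A i) × (∀ i, A i)) (hy : y ∈ diagReachable U C φ)
    (z : (∀ i, A i) × (∀ i, A i)) (hs : PhStep U C y z) :
    z ∈ diagReachable U C φ ∧ V z ≤ V y + phRes U y z :=
  pathValues_step _ _ hV y hy z hs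

lemma reflTransGen_of_edge (hA1 : Assumption1 C) (hA3 : Assumption3 U C)
    (hpot : IsPotentialGame U C φ) (b : ∀ i, A i) {i : ι} {y : A i} (hy : y ∈ C i (b i)) {ρ : ℝ}
    (h1 : 1 - φ b ≤ ρ) (h2 : 1 - φ (Function.update b i y) ≤ ρ) :
    Relation.ReflTransGen (LowStep (PhStep U C) (phRes U) (diagReachable U C φ) V ρ) (b, b)
      (Function.update b i y, Function.update b i y) := by
  obtain ⟨c, hc, hp⟩ := exists_costPath_edge hA1 hA3 hpot b hy
  refine (hp.lowStep (phRes_nonneg U) (diagReachable_step hV) (diag_mem_diagReachable b) ?_).1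
  have := height_diag_le hV b
  rcases max_cases 0 (φ b - φ (Function.update b i y)) with h | h <;> linarith

lemma UniWalk.reflTransGen (hA1 : Assumption1 C) (hA3 : Assumption3 U C)
    (hpot : IsPotentialGame U C φ) {a b : ∀ i, A i} {m : ℕ} (h : UniWalk C a m b) {ρ : ℝ}
    (hρ : 1 + m / 2 - φ a ≤ ρ) :
    Relation.ReflTransGen (LowStep (PhStep U C) (phRes U) (diagReachable U C φ) V ρ) (b, b)
      (a, a) := by
  induction h with
  | refl => exact .refl
  | @snoc m b i y hw hy ih =>
    have h1 := abs_le.1 (hw.abs_potential_sub_le hA1 hA3 hpot)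
    have h2 := abs_le.1 ((hw.snoc hy).abs_potential_sub_le hA1 hA3 hpot)
    push_cast at hρ h2
    have hy' : b i ∈ C i (Function.update b i y i) := by
      rw [Function.update_self]; exact (hA1.1 _ _ _).1 hy
    have hedge := reflTransGen_of_edge hV hA1 hA3 hpot (Function.update b i y) hy' (ρ := ρ)
      (by linarith) (by rw [Function.update_idem, Function.update_eq_self]; linarith)
    rw [Function.update_idem, Function.update_eq_self] at hedge
    exact hedge.trans (ih (by linarith))

/-- A path between diagonal states can be reversed without exceeding its final height. -/
lemma CostPath.reflTransGen_return (hA1 : Assumption1 C) (hA3 : Assumption3 U C)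
    (hpot : IsPotentialGame U C φ) {a b : ∀ i, A i} {t : ℕ} {c : ℝ}
    (h : CostPath (PhStep U C) (phRes U) (a, a) t c (b, b)) :
    Relation.ReflTransGen
      (LowStep (PhStep U C) (phRes U) (diagReachable U C φ) V (-φ a + c)) (b, b) (a, a) := by
  obtain ⟨e, he, h1, -, h3⟩ := h.exists_explorations hpot
  rcases h3 with h3 | h3 | ⟨hk, i, y, hy, h3 | h3 | ⟨h3, hc⟩⟩
  · obtain ⟨m, hm, hw⟩ := exists_uniWalk h1
    refine hw.reflTransGen hV hA1 hA3 hpot ?_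
    have h4 : (2 : ℝ) ≤ (∑ i, e i : ℕ) := by exact_mod_cast h3
    have h5 : (m : ℝ) ≤ (∑ i, e i : ℕ) := by exact_mod_cast hm
    linarith
  · rw [h3]
  · obtain ⟨rfl, -⟩ := Prod.mk.inj h3
    exact .refl
  · obtain ⟨-, rfl⟩ := Prod.mk.inj h3
    exact .refl
  · rw [h3]
    have hy' : a i ∈ C i (Function.update a i y i) := by
      rw [Function.update_self]; exact (hA1.1 _ _ _).1 hy
    have hm1 := le_max_left 0 (φ a - φ (Function.update a i y))
    have hm2 := le_max_right 0 (φ a - φ (Function.update a i y))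
    have hedge := reflTransGen_of_edge hV hA1 hA3 hpot (Function.update a i y) hy'
      (ρ := -φ a + c) (by linarith)
      (by rw [Function.update_idem, Function.update_eq_self]; linarith)
    rwa [Function.update_idem, Function.update_eq_self] at hedge

/-- Every step between reachable states can be undone at its own height. -/
lemma reflTransGen_undo (hA1 : Assumption1 C) (hA3 : Assumption3 U C)
    (hpot : IsPotentialGame U C φ) {z z' : (∀ i, A i) × (∀ i, A i)}
    (hz : z ∈ diagReachable U C φ) (hs : PhStep U C z z') :
    Relation.ReflTransGen
      (LowStep (PhStep U C) (phRes U) (diagReachable U C φ) V (V z + phRes U z z')) z' z := by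
  obtain ⟨a, t, c, hp, hVz⟩ := (hV z hz).1
  have hr := phRes_nonneg U z z'
  have hdiag := height_diag_le hV a
  obtain ⟨hz', hVz'⟩ := diagReachable_step hV z hz z' hs
  obtain ⟨t', b, hb⟩ := exists_costPath_diag U C z'
  have h1 := (hb.lowStep (phRes_nonneg U) (diagReachable_step hV) hz'
    (ρ := V z + phRes U z z') (by linarith)).1
  have h2 := CostPath.reflTransGen_return hV hA1 hA3 hpot ((hp.snoc hs).trans hb)
  have h3 := (hp.lowStep (phRes_nonneg U) (diagReachable_step hV) (diag_mem_diagReachable a)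
    (ρ := V z + phRes U z z') (by linarith)).1
  rw [show -φ a + (c + phRes U z z' + 0) = V z + phRes U z z' by rw [hVz]; ring] at h2
  exact (h1.trans h2).trans h3

lemma exists_reflTransGen (hA1 : Assumption1 C) (hA3 : Assumption3 U C)
    (hpot : IsPotentialGame U C φ) {D : ℕ} (hD : ∀ (i : ι) (x y : A i), ReachIn C i D x y)
    {y z : (∀ i, A i) × (∀ i, A i)} (hy : y ∈ diagReachable U C φ)
    (hz : z ∈ diagReachable U C φ) :
    ∃ ρ, Relation.ReflTransGen
      (LowStep (PhStep U C) (phRes U) (diagReachable U C φ) V ρ) y z := by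
  obtain ⟨t, b, hb⟩ := exists_costPath_diag U C y
  obtain ⟨a, t', c, hp, -⟩ := (hV z hz).1
  obtain ⟨m, -, hw⟩ := exists_uniWalk (a := a) (b := b) fun i => hD i (a i) (b i)
  have h1 := (hb.lowStep (phRes_nonneg U) (diagReachable_step hV) hy le_rfl).1
  have h2 := hw.reflTransGen hV hA1 hA3 hpot le_rfl
  have h3 := (hp.lowStep (phRes_nonneg U) (diagReachable_step hV) (diag_mem_diagReachable a)
    le_rfl).1
  refine ⟨max (V y + 0) (max (1 + m / 2 - φ a) (V (a, a) + c)), ?_⟩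
  refine ((reflTransGen_lowStep_mono ?_ h1).trans (reflTransGen_lowStep_mono ?_ h2)).trans
    (reflTransGen_lowStep_mono ?_ h3)
  · exact le_max_left _ _
  · exact (le_max_left _ _).trans (le_max_right _ _)
  · exact (le_max_right _ _).trans (le_max_right _ _)

/-- States whose second component does not maximize the potential lie strictly above the diagonal
states of maximizers. -/
lemma height_lt_of_not_maximal (hpot : IsPotentialGame U C φ) {b : ∀ i, A i}
    (hb : ∀ a, φ a ≤ φ b) {z : (∀ i, A i) × (∀ i, A i)} (hz : z ∈ diagReachable U C φ)
    (hzb : φ z.2 < φ b) : V (b, b) < V z := by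
  obtain ⟨a, t, c, hp, hVz⟩ := (hV z hz).1
  have hdiag := height_diag_le hV b
  have hab := hb a
  rcases (hp.cost_nonneg (phRes_nonneg U)).eq_or_lt with hc | hc
  · obtain ⟨e, he, -, h2, -⟩ := hp.exists_explorations hpot
    have h0 : ∑ i, e i = 0 := by
      rw [← hc] at he
      exact_mod_cast le_antisymm he (Nat.cast_nonneg _)
    have hza : a = z.2 := funext fun i => by
      have := h2 i
      rwa [(Finset.sum_eq_zero_iff.1 h0) i (Finset.mem_univ i)] at this
    rw [← hza] at hzb
    linarith
  · linarith

end Returns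

section Convergence

variable {ι : Type*} [Fintype ι] [DecidableEq ι] {A : ι → Type*} [∀ i, Fintype (A i)]
  {U : ι → (∀ i, A i) → ℝ} {C : ∀ i, A i → Finset (A i)} {φ : (∀ i, A i) → ℝ}

/-- The probability of occupying a state whose second component does not maximize the potential
vanishes. -/
lemma tendsto_transProd_of_not_maximal [Nonempty ι] (hA1 : Assumption1 C) (hA3 : Assumption3 U C)
    (hpot : IsPotentialGame U C φ) {D : ℕ} (hD : ∀ (i : ι) (x y : A i), ReachIn C i D x y)
    {κ : ℝ} (hκ : 0 < κ) (hκ2 : κ ≤ 1 / 2) (z0 : (∀ i, A i) × (∀ i, A i)) {k0 : ℕ}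
    (hk0 : 1 ≤ k0) {b : ∀ i, A i} (hb : ∀ a, φ a ≤ φ b) {z : (∀ i, A i) × (∀ i, A i)}
    (hz : φ z.2 < φ b) :
    Tendsto (fun m => transProd κ U C (pipipRate (Fintype.card ι) D) k0 m z0 z) atTop (𝓝 0) := by
  have hC := hA1.2.2
  obtain ⟨V, hV⟩ := exists_isLeast_pathValues (Step := PhStep U C) (r := phRes U)
    (fun a : ∀ i, A i => (a, a)) (fun a => -φ a) (phRes_nonneg U)
  obtain ⟨T, hT, hpath⟩ := exists_costPath_target hA1 hA3 hD b
  set N : ℝ := Fintype.card ι * (D + 1) with hN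
  have hN0 : 0 < N := by positivity
  set c₀ : ℝ := ∏ i, κ / (2 * Fintype.card (A i)) with hc₀
  have hcard : ∀ i, (1 : ℝ) ≤ Fintype.card (A i) := fun i => by
    have : Nonempty (A i) := ⟨b i⟩
    exact_mod_cast Fintype.card_pos
  have hc₀pos : 0 < c₀ := Finset.prod_pos fun i _ => by have := hcard i; positivity
  have hc₀1 : c₀ ≤ 1 := Finset.prod_le_one (fun i _ => by positivity) fun i _ => by
    have := hcard i
    rw [div_le_one (by positivity)]
    linarith
  have hst : ∀ x, 0 < x → x ≤ 1 → phMatrix κ U C x ∈ Matrix.rowStochastic ℝ _ :=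
    fun x hx hx1 => phMatrix_mem_rowStochastic U hκ hκ2 hC hx hx1
  have hlow : ∀ x, 0 < x → x ≤ 1 / 2 → ∀ y z, PhStep U C y z →
      c₀ * x ^ phRes U y z ≤ phMatrix κ U C x y z :=
    fun x hx hx1 y z hs => le_phMatrix U hκ hκ2 hC hx hx1 hs
  have hDoeblin : ∀ (ε : ℕ → ℝ) (k : ℕ) (e : ℝ), 0 < e →
      (∀ j < T, e ≤ ε (k + j) ∧ ε (k + j) ≤ 1 / 2) →
      ∀ z, c₀ ^ T * e ^ N ≤ matProd (fun j => phMatrix κ U C (ε j)) k T z (b, b) := by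
    intro ε k e he hε z
    obtain ⟨c, hc, hp⟩ := hpath z
    have he1 : e ≤ 1 := by linarith [(hε 0 hT).1, (hε 0 hT).2]
    refine le_trans ?_ (hp.le_matProd (P := phMatrix κ U C) hc₀pos.le (phRes_nonneg U)
      (fun x hx hx1 y z => Matrix.nonneg_of_mem_rowStochastic (hst x hx (by linarith))) hlow he hε)
    exact mul_le_mul_of_nonneg_left (Real.rpow_le_rpow_of_exponent_ge he he1 hc) (by positivity)
  have hstat : Tendsto (fun x => stationary (phMatrix κ U C x) z) (𝓝[>] 0) (𝓝 0) := by
    refine tendsto_stationary_zero (Step := PhStep U C) (r := phRes U) (X := diagReachable U C φ)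
      (V := V) (b := (b, b)) (y := (b, b)) hc₀pos hc₀1
      (fun x hx hx1 => hst x hx (by linarith)) hlow
      (fun x hx hx1 y z hs => phMatrix_le U hκ hκ2 hC hx hx1 hs)
      (fun x _ _ y z hs => phMatrix_eq_zero U x hs)
      (fun y hy z hs => (diagReachable_step hV y hy z hs).1)
      (fun y hy z hs => reflTransGen_undo hV hA1 hA3 hpot hy hs)
      (fun y hy z hz => exists_reflTransGen hV hA1 hA3 hpot hD hy hz)
      (diag_mem_diagReachable b) hT ?_ (diag_mem_diagReachable b)
      (fun hzX => height_lt_of_not_maximal hV hpot hb hzX hz)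
    intro x hx hx1
    exact ⟨c₀ ^ T * x ^ N, by positivity, hDoeblin (fun _ => x) 0 x hx fun _ _ => ⟨le_rfl, hx1⟩⟩
  have := tendsto_matProd_annealing hst (isPowerSum_phMatrix κ U C) hT hN0 (by positivity)
    hDoeblin hstat z0 hk0
  simpa only [transProd_eq_matProd, pipipRate, hN] using this

end Convergence

section Theorems

variable {ι : Type*} [Fintype ι] [DecidableEq ι] {A : ι → Type*} [∀ i, Fintype (A i)]

theorem statement3 [∀ i, Nonempty (A i)]
    (U : ι → (∀ i, A i) → ℝ) (C : ∀ i, A i → Finset (A i)) (φ : (∀ i, A i) → ℝ)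
    (hA1 : Assumption1 C) (hA3 : Assumption3 U C) (hpot : IsPotentialGame U C φ)
    (D : ℕ) (hD1 : ∀ (i : ι) (x y : A i), ReachIn C i D x y)
    (hD2 : ∀ d : ℕ, d < D → ¬ ∀ (i : ι) (x y : A i), ReachIn C i d x y)
    (Cmax : ℕ)
    (hCmax : Cmax = Finset.univ.sup fun i : ι => Finset.univ.sup fun a : A i => (C i a).card)
    (κ : ℝ) (hκ1 : 1 / ((Cmax : ℝ) - 1) < κ) (hκ2 : κ ≤ 1 / 2)
    (z0 : (∀ i, A i) × (∀ i, A i)) (hz0 : memB C z0) (k0 : ℕ) (hk0 : 1 ≤ k0) :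
    Tendsto (fun k : ℕ => ∑ z' : (∀ i, A i) × (∀ i, A i),
        (if ∀ b, φ b ≤ φ z'.2 then
          transProd κ U C (pipipRate (Fintype.card ι) D) k0 (k - k0) z0 z' else 0))
      atTop (𝓝 1) := by
  obtain ⟨b, hb⟩ := Finite.exists_max φ
  have hbad : ∀ z : (∀ i, A i) × (∀ i, A i), Tendsto (fun k : ℕ => if ∀ b, φ b ≤ φ z.2 then 0 else
      transProd κ U C (pipipRate (Fintype.card ι) D) k0 (k - k0) z0 z) atTop (𝓝 0) := by
    intro z
    split_ifs with hz
    · exact tendsto_const_nhds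
    push Not at hz
    obtain ⟨a, ha⟩ := hz
    have : Nonempty ι := by
      by_contra hι
      rw [not_nonempty_iff] at hι
      exact ha.ne (congrArg φ (Subsingleton.elim _ _))
    have hCmax3 : 3 ≤ Cmax := by
      obtain ⟨i⟩ := this
      rw [hCmax]
      exact ((hA1.2.2 i (b i)).trans (Finset.le_sup (f := fun a : A i => (C i a).card)
        (Finset.mem_univ (b i)))).trans (Finset.le_sup
          (f := fun i : ι => Finset.univ.sup fun a : A i => (C i a).card) (Finset.mem_univ i))
    have hκ : 0 < κ := by
      have h3 : (3 : ℝ) ≤ Cmax := by exact_mod_cast hCmax3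
      exact lt_trans (div_pos one_pos (by linarith)) hκ1
    exact (tendsto_transProd_of_not_maximal hA1 hA3 hpot hD1 hκ hκ2 z0 hk0 hb
      (ha.trans_le (hb a))).comp (tendsto_sub_atTop_nat k0)
  have hlim := (tendsto_const_nhds (x := (1 : ℝ))).sub
    (tendsto_finsetSum Finset.univ fun z _ => hbad z)
  simp only [Finset.sum_const_zero, sub_zero] at hlim
  refine hlim.congr fun k => ?_
  rw [← sum_transProd (κ := κ) U hA1.2.2 (pipipRate (Fintype.card ι) D) k0 (k - k0) z0,
    ← Finset.sum_sub_distrib]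
  refine Finset.sum_congr rfl fun z _ => ?_
  by_cases hz : ∀ b, φ b ≤ φ z.2 <;> simp [hz]

end Theorems
end

section
/- Let z^1 = (a^0, a^1) → z^2 = (a^1, a^2) be a feasible transition of the PHPIP chain {P^ε} (κ ∈ (0,1/2]), and partition the players as Λ1 = {i : U_i(a^1) ≥ U_i(a^0) and a_i^2 ∈ C_i(a_i^1)∖{a_i^1}}, Λ2 = {i : U_i(a^1) ≥ U_i(a^0) and a_i^2 = a_i^1}, Λ3 = {i : U_i(a^1) < U_i(a^0) and a_i^2 ∈ C_i(a_i^1)∖{a_i^0, a_i^1}}, Λ4 = {i : U_i(a^1) < U_i(a^0) and a_i^2 = a_i^1}, Λ5 = {i : U_i(a^1) < U_i(a^0) and a_i^2 = a_i^0}. Then, with Δ_i = U_i(a^0) − U_i(a^1), the resistance of the transition equals |Λ1| + |Λ3| + Σ_{i ∈ Λ4} Δ_i; that is, lim_{ε→0} P^ε_{z^1 z^2} / ε^{|Λ1| + |Λ3| + Σ_{i∈Λ4} Δ_i} is a finite positive number. -/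
open Filter Topology Set

attribute [local instance] Classical.propDecidable

section PlayerResistance

variable {ι : Type*} {A : ι → Type*}

/-- The resistance contributed by a single player moving from `(a0, a1)` to the action `x`. -/
noncomputable def playerRes (U : ι → (∀ i, A i) → ℝ) (C : ∀ i, A i → Finset (A i))
    (a0 a1 : ∀ i, A i) (i : ι) (x : A i) : ℝ :=
  (if U i a0 ≤ U i a1 ∧ x ∈ (C i (a1 i)).erase (a1 i) then 1 else 0) +
    (if U i a1 < U i a0 ∧ x ∈ ((C i (a1 i)).erase (a1 i)).erase (a0 i) then 1 else 0) +
    (if U i a1 < U i a0 ∧ x = a1 i then U i a0 - U i a1 else 0)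

theorem tendsto_div_rpow_of_eq_mul {f g : ℝ → ℝ} {r L : ℝ}
    (hf : ∀ ε, 0 < ε → f ε = g ε * ε ^ r) (hg : Tendsto g (𝓝[>] (0 : ℝ)) (𝓝 L)) :
    Tendsto (fun ε => f ε / ε ^ r) (𝓝[>] (0 : ℝ)) (𝓝 L) := by
  refine hg.congr' ?_
  filter_upwards [self_mem_nhdsWithin] with ε hε
  rw [hf ε hε, mul_div_cancel_right₀ _ (Real.rpow_pos_of_pos hε r).ne']

theorem tendsto_one_sub_nhdsGT_zero :
    Tendsto (fun ε : ℝ => 1 - ε) (𝓝[>] (0 : ℝ)) (𝓝 1) := by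
  have h : Continuous fun ε : ℝ => 1 - ε := by fun_prop
  simpa using (h.tendsto 0).mono_left nhdsWithin_le_nhds

theorem tendsto_rpow_nhdsGT_zero {r : ℝ} (hr : 0 < r) :
    Tendsto (fun ε : ℝ => ε ^ r) (𝓝[>] (0 : ℝ)) (𝓝 0) := by
  have h := (Real.continuousAt_rpow_const 0 r (Or.inr hr.le)).tendsto
  rw [Real.zero_rpow hr.ne'] at h
  exact h.mono_left nhdsWithin_le_nhds

theorem exists_tendsto_selProb_div (U : ι → (∀ i, A i) → ℝ) (C : ∀ i, A i → Finset (A i))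
    {κ : ℝ} (hκ0 : 0 < κ) (a0 a1 : ∀ i, A i) (i : ι) (x : A i)
    (hne : ∃ ε, selProb κ U C ε a0 a1 i x ≠ 0)
    (hpart : U i a1 < U i a0 → x = a1 i → a1 i ≠ a0 i) :
    ∃ L : ℝ, 0 < L ∧
      Tendsto (fun ε : ℝ => selProb κ U C ε a0 a1 i x / ε ^ playerRes U C a0 a1 i x)
        (𝓝[>] (0 : ℝ)) (𝓝 L) := by
  obtain ⟨ε₀, hε₀⟩ := hne
  rcases le_or_gt (U i a0) (U i a1) with hU | hU
  · by_cases hx : x = a1 i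
    · refine ⟨1, one_pos, tendsto_div_rpow_of_eq_mul (fun ε _ => ?_) tendsto_one_sub_nhdsGT_zero⟩
      simp [selProb, playerRes, hU, hU.not_gt, hx]
    · have hmem : x ∈ (C i (a1 i)).erase (a1 i) := by
        by_contra hmem
        exact hε₀ (by simp only [selProb, if_pos hU, if_neg hx, if_neg hmem, add_zero])
      have hcard : (0 : ℝ) < ((C i (a1 i)).erase (a1 i)).card := by
        exact_mod_cast Finset.card_pos.mpr ⟨x, hmem⟩
      refine ⟨_, inv_pos.mpr hcard,
        tendsto_div_rpow_of_eq_mul (fun ε _ => ?_) tendsto_const_nhds⟩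
      have hr : playerRes U C a0 a1 i x = 1 := by
        simp only [playerRes, hU, hmem, hU.not_gt, and_self, false_and, if_true, if_false,
          add_zero]
      rw [hr, Real.rpow_one]
      simp only [selProb, if_pos hU, if_neg hx, if_pos hmem]
      ring
  · have hU' := hU.not_ge
    by_cases hx : x = a1 i
    · have hx0 : x ≠ a0 i := hx ▸ hpart hU hx
      have hmem : x ∉ ((C i (a1 i)).erase (a1 i)).erase (a0 i) := by simp [hx]
      have hr : playerRes U C a0 a1 i x = U i a0 - U i a1 := by
        simp only [playerRes, hU, hU', hx, and_self, false_and, if_true, if_false, zero_add]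
        simp
      refine ⟨κ, hκ0, tendsto_div_rpow_of_eq_mul (g := fun ε => (1 - ε) * κ) (fun ε _ => ?_) ?_⟩
      · rw [hr]
        simp only [selProb, if_neg hU', if_pos hx, if_neg hx0, if_neg hmem]
        ring
      · simpa using tendsto_one_sub_nhdsGT_zero.mul_const κ
    · by_cases hx0 : x = a0 i
      · have hmem : x ∉ ((C i (a1 i)).erase (a1 i)).erase (a0 i) := by simp [hx0]
        have hr : playerRes U C a0 a1 i x = 0 := by
          simp only [playerRes, hU', hmem, hx, and_false, false_and, if_false, add_zero]
        refine ⟨1, one_pos, tendsto_div_rpow_of_eq_mul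
          (g := fun ε => (1 - ε) * (1 - κ * ε ^ (U i a0 - U i a1))) (fun ε _ => ?_) ?_⟩
        · rw [hr, Real.rpow_zero]
          simp only [selProb, if_neg hU', if_neg hx, if_pos hx0, if_neg hmem]
          ring
        · simpa using tendsto_one_sub_nhdsGT_zero.mul
            (((tendsto_rpow_nhdsGT_zero (sub_pos.mpr hU)).const_mul κ).const_sub 1)
      · have hmem : x ∈ ((C i (a1 i)).erase (a1 i)).erase (a0 i) := by
          by_contra hmem
          exact hε₀ (by
            simp only [selProb, if_neg hU', if_neg hx, if_neg hx0, if_neg hmem, add_zero])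
        have hcard : (0 : ℝ) < (((C i (a1 i)).erase (a1 i)).erase (a0 i)).card := by
          exact_mod_cast Finset.card_pos.mpr ⟨x, hmem⟩
        refine ⟨_, inv_pos.mpr hcard,
          tendsto_div_rpow_of_eq_mul (fun ε _ => ?_) tendsto_const_nhds⟩
        have hr : playerRes U C a0 a1 i x = 1 := by
          simp only [playerRes, hU, hU', hmem, hx, and_self, and_false, false_and, if_true,
            if_false, add_zero, zero_add]
        rw [hr, Real.rpow_one]
        simp only [selProb, if_neg hU', if_neg hx, if_neg hx0, if_pos hmem]
        ring

end PlayerResistance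

section Theorems

variable {ι : Type*} [Fintype ι] [DecidableEq ι] {A : ι → Type*} [∀ i, Fintype (A i)]

theorem statement6
    (U : ι → (∀ i, A i) → ℝ) (C : ∀ i, A i → Finset (A i))
    (κ : ℝ) (hκ0 : 0 < κ) (hκ : κ ≤ 1 / 2)
    (a0 a1 a2 : ∀ i, A i)
    (hfeas : ∃ ε : ℝ, 0 < ε ∧ ε ≤ 1 / 2 ∧ 0 < phTrans κ U C ε (a0, a1) (a1, a2))
    (hpart : ∀ i, U i a1 < U i a0 → a2 i = a1 i → a1 i ≠ a0 i) :
    ∃ L : ℝ, 0 < L ∧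
      Tendsto (fun ε : ℝ => phTrans κ U C ε (a0, a1) (a1, a2) /
          ε ^ (((Finset.univ.filter fun i : ι =>
                  U i a0 ≤ U i a1 ∧ a2 i ∈ (C i (a1 i)).erase (a1 i)).card : ℝ)
            + ((Finset.univ.filter fun i : ι =>
                  U i a1 < U i a0 ∧ a2 i ∈ ((C i (a1 i)).erase (a1 i)).erase (a0 i)).card : ℝ)
            + ∑ i ∈ Finset.univ.filter fun i : ι => U i a1 < U i a0 ∧ a2 i = a1 i,
                (U i a0 - U i a1)))
        (𝓝[>] (0 : ℝ)) (𝓝 L) := by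
  obtain ⟨ε₀, -, -, hε₀⟩ := hfeas
  simp only [phTrans, if_true] at hε₀ ⊢
  have hne : ∀ i, selProb κ U C ε₀ a0 a1 i (a2 i) ≠ 0 := fun i =>
    Finset.prod_ne_zero_iff.mp hε₀.ne' i (Finset.mem_univ i)
  choose L hL hlim using fun i =>
    exists_tendsto_selProb_div U C hκ0 a0 a1 i (a2 i) ⟨ε₀, hne i⟩ (hpart i)
  refine ⟨∏ i, L i, Finset.prod_pos fun i _ => hL i, ?_⟩
  refine (tendsto_finsetProd Finset.univ fun i _ => hlim i).congr' ?_
  filter_upwards [self_mem_nhdsWithin] with ε hε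
  rw [Finset.prod_div_distrib, ← Real.rpow_sum_of_pos hε]
  congr 2
  simp only [playerRes, Finset.sum_add_distrib, Finset.sum_filter, Finset.card_filter,
    Nat.cast_sum, Nat.cast_ite, Nat.cast_one, Nat.cast_zero]

end Theorems
end

section
/- Under Assumption 1, the recurrent communication classes of the unperturbed Markov chain {P^0} induced by PHPIP are exactly the singletons {(a,a)} for a ∈ A: every state of diag(A) = {(a,a) : a ∈ A} forms its own recurrent communication class, and no state of B ∖ diag(A) belongs to any recurrent communication class of {P^0}. -/
open Filter Topology Set

attribute [local instance] Classical.propDecidable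

section UnperturbedDynamics

variable {ι : Type*} {A : ι → Type*}

/-- The deterministic one-step map of the unperturbed chain `{P^0}`. -/
noncomputable def unperturbedStep (U : ι → (∀ i, A i) → ℝ)
    (z : (∀ i, A i) × (∀ i, A i)) : (∀ i, A i) × (∀ i, A i) :=
  (z.2, fun i => if U i z.1 ≤ U i z.2 then z.2 i else z.1 i)

theorem unperturbedStep_diag (U : ι → (∀ i, A i) → ℝ) (a : ∀ i, A i) :
    unperturbedStep U (a, a) = (a, a) := by
  simp [unperturbedStep]

theorem unperturbedStep_coord_eq (U : ι → (∀ i, A i) → ℝ) {z : (∀ i, A i) × (∀ i, A i)} {i : ι}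
    (h : z.1 i = z.2 i) : (unperturbedStep U z).1 i = (unperturbedStep U z).2 i := by
  simp [unperturbedStep, h]

theorem iterate_unperturbedStep_coord_eq (U : ι → (∀ i, A i) → ℝ)
    {z : (∀ i, A i) × (∀ i, A i)} {i : ι} (h : z.1 i = z.2 i) (k : ℕ) :
    ((unperturbedStep U)^[k] z).1 i = ((unperturbedStep U)^[k] z).2 i := by
  induction k with
  | zero => exact h
  | succ k ih =>
    rw [Function.iterate_succ_apply']
    exact unperturbedStep_coord_eq U ih

theorem utility_lt_of_unperturbedStep_coord_ne (U : ι → (∀ i, A i) → ℝ)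
    {z : (∀ i, A i) × (∀ i, A i)} {i : ι}
    (h : (unperturbedStep U z).1 i ≠ (unperturbedStep U z).2 i) :
    U i (unperturbedStep U z).1 < U i z.1 := by
  by_contra! hle
  exact h (by simp only [unperturbedStep] at hle ⊢; rw [if_pos hle])

/-- Along a cycle a non-constant coordinate would make the utility strictly decrease forever. -/
theorem diag_of_periodic_unperturbedStep (U : ι → (∀ i, A i) → ℝ)
    {z : (∀ i, A i) × (∀ i, A i)} {m : ℕ}
    (hm : (unperturbedStep U)^[m + 1] z = z) : z.1 = z.2 := by
  funext i
  by_contra hne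
  have hper : Function.IsPeriodicPt (unperturbedStep U) (m + 1) z := hm
  have hk : ∀ k, ((unperturbedStep U)^[k] z).1 i ≠ ((unperturbedStep U)^[k] z).2 i := by
    intro k hk
    apply hne
    have hiter := iterate_unperturbedStep_coord_eq U hk (m * k)
    rw [← Function.iterate_add_apply, show m * k + k = (m + 1) * k by ring,
      (hper.mul_const k).eq] at hiter
    exact hiter
  have hanti : StrictAnti fun k => U i ((unperturbedStep U)^[k] z).1 := by
    refine strictAnti_nat_of_succ_lt fun k => ?_
    have h := hk (k + 1)
    rw [Function.iterate_succ_apply'] at h ⊢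
    exact utility_lt_of_unperturbedStep_coord_ne U h
  have h := hanti m.succ_pos
  simp only [Nat.succ_eq_add_one, hm, Function.iterate_zero, id] at h
  exact lt_irrefl _ h

theorem selProb_zero (κ : ℝ) (U : ι → (∀ i, A i) → ℝ) (C : ∀ i, A i → Finset (A i))
    (z : (∀ i, A i) × (∀ i, A i)) (i : ι) (x : A i) :
    selProb κ U C 0 z.1 z.2 i x = if x = (unperturbedStep U z).2 i then 1 else 0 := by
  unfold selProb unperturbedStep
  by_cases h : U i z.1 ≤ U i z.2
  · simp [h]
  · have h0 : (0 : ℝ) ^ (U i z.1 - U i z.2) = 0 :=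
      Real.zero_rpow (sub_ne_zero.mpr (not_le.mp h).ne')
    simp [h, h0]

variable [Fintype ι]

theorem phTrans_zero (κ : ℝ) (U : ι → (∀ i, A i) → ℝ) (C : ∀ i, A i → Finset (A i))
    (z w : (∀ i, A i) × (∀ i, A i)) :
    phTrans κ U C 0 z w = if w = unperturbedStep U z then 1 else 0 := by
  simp only [phTrans, selProb_zero, Finset.prod_ite_zero, Finset.prod_const_one,
    ← ite_and]
  congr 1
  simp [Prod.ext_iff, funext_iff, unperturbedStep]

variable [DecidableEq ι] [∀ i, Fintype (A i)]

theorem phTransPow_zero (κ : ℝ) (U : ι → (∀ i, A i) → ℝ) (C : ∀ i, A i → Finset (A i))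
    (k : ℕ) (z z' : (∀ i, A i) × (∀ i, A i)) :
    phTransPow κ U C 0 k z z' = if (unperturbedStep U)^[k] z = z' then 1 else 0 := by
  induction k generalizing z with
  | zero => rfl
  | succ k ih =>
    simp only [phTransPow, phTrans_zero, ih, ite_mul, one_mul, zero_mul, Finset.sum_ite_eq',
      Finset.mem_univ, if_true, Function.iterate_succ_apply]
    congr

theorem accessible0_iff (κ : ℝ) (U : ι → (∀ i, A i) → ℝ) (C : ∀ i, A i → Finset (A i))
    (z z' : (∀ i, A i) × (∀ i, A i)) :
    Accessible0 κ U C z z' ↔ ∃ k, (unperturbedStep U)^[k] z = z' := by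
  refine exists_congr fun k => ?_
  rw [phTransPow_zero]
  split_ifs with h <;> simp [h]

end UnperturbedDynamics

section Theorems

variable {ι : Type*} [Fintype ι] [DecidableEq ι] {A : ι → Type*} [∀ i, Fintype (A i)]

theorem statement7
    (U : ι → (∀ i, A i) → ℝ) (C : ∀ i, A i → Finset (A i))
    (κ : ℝ) (hκ0 : 0 < κ) (hκ : κ ≤ 1 / 2) (hA1 : Assumption1 C) :
    (∀ a : ∀ i, A i, IsRecClass κ U C {(a, a)}) ∧
    (∀ H : Set ((∀ i, A i) × (∀ i, A i)), IsRecClass κ U C H →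
      ∀ z ∈ H, memB C z → z.1 = z.2) := by
  refine ⟨fun a => ⟨Set.singleton_nonempty _, ?_, ?_⟩, fun H hH z hz _ => ?_⟩
  · rintro z rfl z' rfl
    exact (accessible0_iff ..).mpr ⟨0, rfl⟩
  · rintro z rfl z' h
    obtain ⟨k, rfl⟩ := (accessible0_iff ..).mp h
    exact Function.iterate_fixed (unperturbedStep_diag U a) k
  · obtain ⟨-, hcomm, hclosed⟩ := hH
    have hstep : unperturbedStep U z ∈ H :=
      hclosed z hz _ ((accessible0_iff ..).mpr ⟨1, rfl⟩)
    obtain ⟨m, hm⟩ := (accessible0_iff ..).mp (hcomm _ hstep z hz)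
    exact diag_of_periodic_unperturbedStep U hm

end Theorems
end
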